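/- There is an absolute constant C such that the following holds. Let x ≥ 3 and (log x)^{1.1} ≤ y ≤ x^{1/3}, let q ≥ 1 be an integer, δ ∈ ℝ, L = 2(1 + |δx|), and let j be an integer with 0 ≤ j ≤ (log y)/(log 2). Define 𝔗_j(r) = max_{1 ≤ b ≤ r−1} #{(n₁, n₂) : n₁, n₂ positive y-smooth integers ≤ x/(2^j qLy) with n₁ ≡ n₂ + b (mod r)}. Then 𝔗_j(q) ≤ C·( Ψ(x/(2^j qLy), y)²·q^{−α(x,y)}·log x + y·Ψ(x/(2^j qLy), y) ). -/

import Mathlib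

open scoped Classical

noncomputable section

/-- `n` is `y`-smooth: every prime factor of `n` is at most `y`. -/
def IsSmooth (y : ℝ) (n : ℕ) : Prop := ∀ p : ℕ, p.Prime → p ∣ n → (p : ℝ) ≤ y

/-- `Ψ(X, y)`: the number of `y`-smooth integers `n` with `1 ≤ n ≤ X`. -/
def Psi (X y : ℝ) : ℕ := Nat.card {n : ℕ | 1 ≤ n ∧ (n : ℝ) ≤ X ∧ IsSmooth y n}

/-- `e(t) = exp(2πit)`. -/
def e2pi (t : ℝ) : ℂ := Complex.exp (2 * Real.pi * Complex.I * t)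

/-- `alphaEq x y a` says `a` solves `∑_{p ≤ y prime} log p / (p^a - 1) = log x`,
i.e. `a = α(x, y)`. -/
def alphaEq (x y a : ℝ) : Prop :=
  ∑ p ∈ (Finset.range (⌊y⌋₊ + 1)).filter Nat.Prime,
    Real.log p / ((p : ℝ) ^ a - 1) = Real.log x
/-- The number of ordered pairs of positive `y`-smooth integers `n₁, n₂ ≤ X`
with `n₁ ≡ n₂ + b (mod r)`. -/
def Tcount (y X : ℝ) (r b : ℕ) : ℕ :=
  Nat.card {nn : ℕ × ℕ | 1 ≤ nn.1 ∧ 1 ≤ nn.2 ∧ (nn.1 : ℝ) ≤ X ∧ (nn.2 : ℝ) ≤ X ∧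
    IsSmooth y nn.1 ∧ IsSmooth y nn.2 ∧ nn.1 ≡ nn.2 + b [MOD r]}

/-- `𝔗_j(r)`: the maximum over `1 ≤ b ≤ r − 1` of `Tcount y X r b`. -/
def Tmax (y X : ℝ) (r : ℕ) : ℕ := (Finset.Icc 1 (r - 1)).sup (Tcount y X r)

namespace SmoothCong

open Real Finset

/-- The positive `y`-smooth integers up to `Y`. -/
def smoothUpTo (Y y : ℝ) : Finset ℕ := (Icc 1 ⌊Y⌋₊).filter (IsSmooth y)

lemma mem_smoothUpTo {Y y : ℝ} {n : ℕ} :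
    n ∈ smoothUpTo Y y ↔ 1 ≤ n ∧ (n : ℝ) ≤ Y ∧ IsSmooth y n := by
  simp only [smoothUpTo, mem_filter, mem_Icc, and_assoc]
  constructor
  · rintro ⟨h1, h2, h3⟩
    exact ⟨h1, (Nat.le_floor_iff' (by omega)).1 h2, h3⟩
  · rintro ⟨h1, h2, h3⟩
    exact ⟨h1, (Nat.le_floor_iff' (by omega)).2 h2, h3⟩

lemma Psi_eq_card (Y y : ℝ) : Psi Y y = (smoothUpTo Y y).card := by
  have : {n : ℕ | 1 ≤ n ∧ (n : ℝ) ≤ Y ∧ IsSmooth y n} = (smoothUpTo Y y : Set ℕ) := by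
    ext n
    simp [mem_smoothUpTo]
  rw [Psi, this]
  simp

lemma Psi_mono {Y Z : ℝ} (y : ℝ) (h : Y ≤ Z) : Psi Y y ≤ Psi Z y := by
  rw [Psi_eq_card, Psi_eq_card]
  refine card_le_card fun n hn => ?_
  rw [mem_smoothUpTo] at hn ⊢
  exact ⟨hn.1, hn.2.1.trans h, hn.2.2⟩

lemma Psi_mono_real {Y Z : ℝ} (y : ℝ) (h : Y ≤ Z) : (Psi Y y : ℝ) ≤ Psi Z y := by
  exact_mod_cast Psi_mono y h

lemma Psi_eq_zero {Y : ℝ} (y : ℝ) (h : Y < 1) : Psi Y y = 0 := by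
  rw [Psi_eq_card, card_eq_zero, eq_empty_iff_forall_notMem]
  intro n hn
  rw [mem_smoothUpTo] at hn
  have : (1 : ℝ) ≤ n := by exact_mod_cast hn.1
  linarith [hn.2.1]

lemma isSmooth_of_dvd {y : ℝ} {m n : ℕ} (hn : IsSmooth y n) (h : m ∣ n) : IsSmooth y m :=
  fun p hp hpm => hn p hp (hpm.trans h)

lemma isSmooth_mul {y : ℝ} {m n : ℕ} (hm : IsSmooth y m) (hn : IsSmooth y n) :
    IsSmooth y (m * n) := by
  intro p hp h
  rcases (hp.dvd_mul).1 h with h | h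
  · exact hm p hp h
  · exact hn p hp h

lemma isSmooth_prime_pow {y : ℝ} {p : ℕ} (hp : p.Prime) (h : (p : ℝ) ≤ y) (a : ℕ) :
    IsSmooth y (p ^ a) := by
  intro r hr hra
  rw [(Nat.prime_dvd_prime_iff_eq hr hp).1 (hr.dvd_of_dvd_pow hra)]
  exact h

/-- The primes up to `y`. -/
def primesUpTo (y : ℝ) : Finset ℕ := (range (⌊y⌋₊ + 1)).filter Nat.Prime

lemma mem_primesUpTo {y : ℝ} {p : ℕ} (hy : 0 ≤ y) :
    p ∈ primesUpTo y ↔ p.Prime ∧ (p : ℝ) ≤ y := by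
  simp only [primesUpTo, mem_filter, mem_range, Nat.lt_succ_iff]
  rw [Nat.le_floor_iff hy, and_comm]

lemma sum_log_primesUpTo (y : ℝ) : ∑ p ∈ primesUpTo y, log p = Chebyshev.theta y := by
  rw [Chebyshev.theta, primesUpTo]
  refine sum_congr ?_ fun _ _ => rfl
  ext p
  simp only [mem_filter, mem_range, mem_Ioc]
  constructor
  · rintro ⟨h, hp⟩
    exact ⟨⟨hp.pos, by omega⟩, hp⟩
  · rintro ⟨h, hp⟩
    exact ⟨by omega, hp⟩

lemma Psi_div_le_card_dvd (Y : ℝ) {y : ℝ} {d : ℕ} (hd : 0 < d) (hs : IsSmooth y d) :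
    Psi (Y / d) y ≤ ((smoothUpTo Y y).filter (d ∣ ·)).card := by
  rw [Psi_eq_card]
  refine card_le_card_of_injOn (fun m => d * m) ?_ ?_
  · intro m hm
    have hm' := mem_smoothUpTo.1 hm
    have hd' : (0 : ℝ) < d := by exact_mod_cast hd
    simp only [coe_filter, Set.mem_ofPred_eq, mem_smoothUpTo]
    refine ⟨⟨Nat.mul_pos hd hm'.1, ?_, isSmooth_mul hs hm'.2.2⟩, dvd_mul_right _ _⟩
    push_cast
    have := (le_div_iff₀ hd').1 hm'.2.1
    linarith
  · intro a _ b _ h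
    exact Nat.eq_of_mul_eq_mul_left hd h

lemma card_dvd_le_Psi_div (Y y : ℝ) {d : ℕ} (hd : 0 < d) :
    ((smoothUpTo Y y).filter (d ∣ ·)).card ≤ Psi (Y / d) y := by
  rw [Psi_eq_card]
  refine card_le_card_of_injOn (fun m => m / d) ?_ ?_
  · intro m hm
    simp only [coe_filter, Set.mem_ofPred_eq, mem_smoothUpTo] at hm
    have hd' : (0 : ℝ) < d := by exact_mod_cast hd
    obtain ⟨⟨h1, h2, h3⟩, e, rfl⟩ := hm
    simp only [Nat.mul_div_cancel_left e hd]
    refine mem_smoothUpTo.2 ⟨Nat.pos_of_mul_pos_left h1, ?_, isSmooth_of_dvd h3 (dvd_mul_left _ _)⟩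
    rw [le_div_iff₀ hd']
    push_cast at h2
    linarith
  · intro a ha b hb h
    simp only [coe_filter, Set.mem_ofPred_eq] at ha hb
    exact (Nat.div_left_inj ha.2 hb.2).1 h

/-- Each prime power divisor of `n` is counted with weight `log p`. -/
lemma sum_log_dvd_le_log (s : Finset ℕ) (hs : ∀ p ∈ s, p.Prime) (A : ℕ → ℕ) {n : ℕ}
    (hn : n ≠ 0) :
    ∑ t ∈ s.sigma (fun p => Icc 1 (A p)), (if t.1 ^ t.2 ∣ n then log t.1 else 0) ≤ log n := by
  rw [sum_sigma]
  have hlog : log n = ∑ p ∈ n.primeFactors, (n.factorization p : ℝ) * log p := by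
    conv_lhs => rw [← Nat.prod_factorization_pow_eq_self hn]
    rw [Finsupp.prod, Nat.cast_prod, log_prod]
    · simp
    · intro p hp
      have := (Nat.prime_of_mem_primeFactors hp).pos
      positivity
  have hin : ∀ p ∈ s, ∑ a ∈ Icc 1 (A p), (if p ^ a ∣ n then log p else 0) ≤
      (n.factorization p : ℝ) * log p := by
    intro p hp
    rw [← sum_filter, sum_const, nsmul_eq_mul]
    have hc : ((Icc 1 (A p)).filter (fun a => p ^ a ∣ n)).card ≤ n.factorization p := by
      calc _ ≤ (Icc 1 (n.factorization p)).card := by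
            refine card_le_card fun a ha => ?_
            simp only [mem_filter, mem_Icc] at ha ⊢
            exact ⟨ha.1.1, ((hs p hp).pow_dvd_iff_le_factorization hn).1 ha.2⟩
        _ = _ := by simp
    have : 0 ≤ log p := log_natCast_nonneg p
    gcongr
  calc _ ≤ ∑ p ∈ s, (n.factorization p : ℝ) * log p := sum_le_sum hin
    _ = ∑ p ∈ s.filter (· ∈ n.primeFactors), (n.factorization p : ℝ) * log p := by
        rw [sum_filter]
        refine sum_congr rfl fun p _ => ?_
        split_ifs with h
        · rfl
        · rw [Nat.support_factorization n |>.symm, Finsupp.notMem_support_iff] at h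
          simp [h]
    _ ≤ ∑ p ∈ n.primeFactors, (n.factorization p : ℝ) * log p := by
        refine sum_le_sum_of_subset_of_nonneg (fun p hp => (mem_filter.1 hp).2) ?_
        intro p _ _
        have : 0 ≤ log p := log_natCast_nonneg p
        positivity
    _ = log n := hlog.symm

/-- Averaging `log n` over smooth numbers. -/
lemma sum_log_mul_Psi_le {Y y : ℝ} (hy : 0 ≤ y) (A : ℕ → ℕ) :
    ∑ t ∈ (primesUpTo y).sigma (fun p => Icc 1 (A p)),
      log t.1 * Psi (Y / (t.1 ^ t.2 : ℕ)) y ≤ log Y * Psi Y y := by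
  calc _ ≤ ∑ t ∈ (primesUpTo y).sigma (fun p => Icc 1 (A p)),
        ∑ n ∈ smoothUpTo Y y, (if t.1 ^ t.2 ∣ n then log t.1 else 0) := by
        refine sum_le_sum fun t ht => ?_
        have hp := (mem_primesUpTo hy).1 (mem_sigma.1 ht).1
        rw [← sum_filter, sum_const, nsmul_eq_mul, mul_comm]
        have : 0 ≤ log t.1 := log_natCast_nonneg _
        gcongr
        exact Psi_div_le_card_dvd Y (pow_pos hp.1.pos _) (isSmooth_prime_pow hp.1 hp.2 _)
    _ = ∑ n ∈ smoothUpTo Y y, ∑ t ∈ (primesUpTo y).sigma (fun p => Icc 1 (A p)),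
         (if t.1 ^ t.2 ∣ n then log t.1 else 0) := sum_comm
    _ ≤ ∑ n ∈ smoothUpTo Y y, log Y := by
        refine sum_le_sum fun n hn => ?_
        have hn := mem_smoothUpTo.1 hn
        have : (0 : ℝ) < n := by exact_mod_cast hn.1
        exact (sum_log_dvd_le_log _ (fun p hp => ((mem_primesUpTo hy).1 hp).1) A
          (by omega)).trans (log_le_log this hn.2.1)
    _ = _ := by rw [sum_const, nsmul_eq_mul, Psi_eq_card, mul_comm]

lemma exists_theta_lower : ∃ c : ℝ, 0 < c ∧ c ≤ 1 ∧ ∀ x : ℝ, 2 ≤ x → c * x ≤ Chebyshev.theta x := by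
  have hlarge : ∀ x : ℝ, (64 : ℝ) ^ 4 ≤ x → x / 2 ≤ Chebyshev.theta x := by
    intro x hx
    have hx0 : 0 ≤ x := by linarith [show (0 : ℝ) ≤ 64 ^ 4 by norm_num]
    obtain ⟨t, ht, hxt⟩ : ∃ t : ℝ, 64 ≤ t ∧ x = t ^ 4 := by
      refine ⟨x ^ ((1 : ℝ) / 4), ?_, ?_⟩
      · calc (64 : ℝ) = ((64 : ℝ) ^ (4 : ℕ)) ^ ((1 : ℝ) / 4) := by
              rw [← rpow_natCast, ← rpow_mul (by norm_num)]; norm_num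
          _ ≤ _ := by gcongr
      · rw [← rpow_natCast, ← rpow_mul hx0]; norm_num
    have h := Chebyshev.theta_ge' (x := x) (by linarith [show (1 : ℝ) ≤ 64 ^ 4 by norm_num])
    have hs : √x = t ^ 2 := by
      rw [hxt, show t ^ 4 = (t ^ 2) ^ 2 by ring, sqrt_sq (by positivity)]
    have hl : log x ≤ 4 * t := by
      rw [hxt, log_pow]
      have := log_le_sub_one_of_pos (show 0 < t by linarith)
      push_cast
      linarith
    have hl2 : log (x + 2) ≤ 4 * t + 1 := by
      calc log (x + 2) ≤ log (2 * x) := by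
            apply log_le_log <;> linarith [show (2 : ℝ) ≤ 64 ^ 4 by norm_num]
        _ = log 2 + log x := by
            rw [log_mul (by norm_num)]
            linarith [show (2 : ℝ) ≤ 64 ^ 4 by norm_num]
        _ ≤ _ := by linarith [log_two_lt_d9]
    have h2 := log_two_gt_d9
    have h3 : 2 * √x * log x ≤ 8 * t ^ 3 := by
      rw [hs]
      nlinarith [sq_nonneg t]
    have h5 : (0.69 : ℝ) * (x - 1) ≤ (x - 1) * log 2 := by
      have : 0 ≤ x - 1 := by linarith [show (1 : ℝ) ≤ 64 ^ 4 by norm_num]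
      nlinarith
    have h6 : t ^ 4 * 0.19 ≥ 8 * t ^ 3 + 4 * t + 2 := by
      have : t ^ 3 ≥ 1 + t := by nlinarith [sq_nonneg t]
      have : t ^ 4 ≥ 64 * t ^ 3 := by
        have : t ^ 4 = t * t ^ 3 := by ring
        rw [this]
        have : 0 ≤ t ^ 3 := by positivity
        gcongr
      nlinarith
    nlinarith
  refine ⟨1 / (2 * 64 ^ 4), by norm_num, by norm_num, fun x hx => ?_⟩
  rcases le_total ((64 : ℝ) ^ 4) x with h | h
  · refine le_trans ?_ (hlarge x h)
    norm_num
    linarith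
  · have h1 : log 2 ≤ Chebyshev.theta x := by
      calc log 2 = Chebyshev.theta 2 := by
            rw [Chebyshev.theta]
            have : (Ioc 0 ⌊(2 : ℝ)⌋₊).filter Nat.Prime = {2} := by
              rw [show ⌊(2 : ℝ)⌋₊ = 2 by norm_num]
              decide
            rw [this]
            simp
        _ ≤ _ := Chebyshev.theta_mono hx
    have h2 := log_two_gt_d9
    refine le_trans ?_ h1
    rw [div_mul_eq_mul_div, one_mul, div_le_iff₀ (by norm_num)]
    norm_num at h ⊢
    linarith

/-- Chebyshev's bounds on `B`-adic blocks. -/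
lemma exists_theta_block : ∃ (B : ℕ) (c : ℝ), 3 ≤ B ∧ 0 < c ∧ c ≤ 1 ∧ ∀ k : ℕ, 1 ≤ k →
    c * (B : ℝ) ^ k ≤ Chebyshev.theta ((B : ℝ) ^ k) - Chebyshev.theta ((B : ℝ) ^ (k - 1)) := by
  obtain ⟨c, hc, hc1, h⟩ := exists_theta_lower
  obtain ⟨B, hB⟩ := exists_nat_ge (2 * log 4 / c + 3)
  have hB3 : (3 : ℝ) ≤ B := by
    have : 0 ≤ 2 * log 4 / c := by positivity
    linarith
  refine ⟨B, c / 2, by exact_mod_cast hB3, by positivity, by linarith, fun k hk => ?_⟩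
  obtain ⟨m, rfl⟩ : ∃ m, k = m + 1 := ⟨k - 1, by omega⟩
  have hm : (1 : ℝ) ≤ (B : ℝ) ^ m := one_le_pow₀ (by linarith)
  have h1 := h ((B : ℝ) ^ (m + 1)) (by rw [pow_succ]; nlinarith)
  have h2 := Chebyshev.theta_le_log4_mul_x (x := (B : ℝ) ^ m) (by positivity)
  have h3 : log 4 ≤ c / 2 * B := by
    have : 2 * log 4 / c ≤ B := by linarith
    rw [div_le_iff₀ hc] at this
    linarith
  simp only [Nat.add_sub_cancel]
  have h4 : log 4 * (B : ℝ) ^ m ≤ c / 2 * B ^ (m + 1) := by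
    rw [pow_succ]
    nlinarith
  linarith

/-- An upper bound of Mertens type. -/
lemma sum_log_div_le {y : ℝ} (hy : 1 ≤ y) :
    ∑ p ∈ primesUpTo y, log p / p ≤ log y + log 4 := by
  set n := ⌊y⌋₊ with hn
  have hn1 : 1 ≤ n := Nat.le_floor (by simpa using hy)
  have hnR : (1 : ℝ) ≤ n := by exact_mod_cast hn1
  have hny : (n : ℝ) ≤ y := Nat.floor_le (by linarith)
  have h1 : ∑ p ∈ primesUpTo y, ((n : ℝ) / p - 1) * log p ≤ n * log n := by
    calc _ ≤ ∑ p ∈ primesUpTo y, ∑ m ∈ Icc 1 n, (if p ∣ m then log p else 0) := by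
          refine sum_le_sum fun p hp => ?_
          have hp := (mem_primesUpTo (by linarith)).1 hp
          rw [← sum_filter, sum_const, nsmul_eq_mul]
          have h0 : 0 ≤ log p := log_natCast_nonneg _
          have : ((Icc 1 n).filter (p ∣ ·)).card = n / p := by
            have := Nat.Ioc_filter_dvd_card_eq_div n p
            rw [← this]
            congr 1
          rw [this]
          gcongr
          have := Nat.lt_floor_add_one ((n : ℝ) / p)
          rw [Nat.floor_div_natCast, Nat.floor_natCast] at this
          linarith
      _ = ∑ m ∈ Icc 1 n, ∑ p ∈ primesUpTo y, (if p ∣ m then log p else 0) := sum_comm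
      _ ≤ ∑ m ∈ Icc 1 n, log n := by
          refine sum_le_sum fun m hm => ?_
          rw [mem_Icc] at hm
          have h := sum_log_dvd_le_log (primesUpTo y)
            (fun p hp => ((mem_primesUpTo (by linarith)).1 hp).1) (fun _ => 1) (n := m) (by omega)
          rw [sum_sigma] at h
          simp only [Icc_self, sum_singleton, pow_one] at h
          refine h.trans (log_le_log (by exact_mod_cast hm.1) (by exact_mod_cast hm.2))
      _ = _ := by simp
  have h2 : ∑ p ∈ primesUpTo y, ((n : ℝ) / p - 1) * log p =
      n * ∑ p ∈ primesUpTo y, log p / p - Chebyshev.theta y := by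
    rw [← sum_log_primesUpTo, mul_sum, ← sum_sub_distrib]
    refine sum_congr rfl fun p _ => ?_
    ring
  have h3 : Chebyshev.theta y ≤ log 4 * n := by
    rw [Chebyshev.theta_eq_theta_coe_floor]
    exact Chebyshev.theta_le_log4_mul_x (by positivity)
  have h4 : log n ≤ log y := log_le_log (by linarith) hny
  rw [h2] at h1
  have h5 : (n : ℝ) * ∑ p ∈ primesUpTo y, log p / p ≤ n * (log y + log 4) := by
    nlinarith
  exact le_of_mul_le_mul_left h5 (by linarith)

/-- The sum defining `α(x, y)`. -/
def saddleSum (y β : ℝ) : ℝ := ∑ p ∈ primesUpTo y, log p / ((p : ℝ) ^ β - 1)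

/-- The constant `1 - 2 ^ (-1/20)`. -/
def kap : ℝ := 1 - 2 ^ (-(1 / 20 : ℝ))

lemma kap_pos : 0 < kap := by
  have : (2 : ℝ) ^ (-(1 / 20 : ℝ)) < 1 := rpow_lt_one_of_one_lt_of_neg (by norm_num) (by norm_num)
  unfold kap
  linarith

lemma kap_le_one : kap ≤ 1 := by
  have : (0 : ℝ) ≤ (2 : ℝ) ^ (-(1 / 20 : ℝ)) := by positivity
  unfold kap
  linarith

lemma kap_le_one_sub {α p : ℝ} (hα : 1 / 20 ≤ α) (hp : 2 ≤ p) : kap ≤ 1 - p ^ (-α) := by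
  have : p ^ (-α) ≤ (2 : ℝ) ^ (-(1 / 20 : ℝ)) := by
    calc p ^ (-α) ≤ p ^ (-(1 / 20 : ℝ)) :=
          rpow_le_rpow_of_exponent_le (by linarith) (by linarith)
      _ ≤ _ := rpow_le_rpow_of_nonpos (by norm_num) hp (by norm_num)
  unfold kap
  linarith

lemma kap_mul_le {α p : ℝ} (hα : 1 / 20 ≤ α) (hp : 2 ≤ p) : kap * p ^ α ≤ p ^ α - 1 := by
  have h := kap_le_one_sub hα hp
  have h0 : 0 < p ^ α := rpow_pos_of_pos (by linarith) _
  have h1 : p ^ (-α) * p ^ α = 1 := by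
    rw [← rpow_add (by linarith)]
    simp
  nlinarith

lemma term_le {α : ℝ} (hα : 1 / 20 ≤ α) {p : ℕ} (hp : p.Prime) :
    log p / ((p : ℝ) ^ α - 1) ≤ kap⁻¹ * (log p * (p : ℝ) ^ (-α)) := by
  have h2 : (2 : ℝ) ≤ p := by exact_mod_cast hp.two_le
  have h := kap_mul_le hα h2
  have h0 : 0 < (p : ℝ) ^ α := rpow_pos_of_pos (by linarith) _
  have hk := kap_pos
  have hl : 0 ≤ log p := log_natCast_nonneg _
  calc log p / ((p : ℝ) ^ α - 1) ≤ log p / (kap * (p : ℝ) ^ α) := by gcongr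
    _ = _ := by
      rw [rpow_neg (by linarith)]
      field_simp

lemma saddleSum_le_pow {y α : ℝ} (hy : 1 ≤ y) (hα : 1 / 20 ≤ α) (hα1 : α ≤ 1) :
    saddleSum y α ≤ kap⁻¹ * y ^ (1 - α) * (log y + log 4) := by
  have hk := kap_pos
  calc saddleSum y α ≤ ∑ p ∈ primesUpTo y, kap⁻¹ * y ^ (1 - α) * (log p / p) := by
        refine sum_le_sum fun p hp => ?_
        have hp := (mem_primesUpTo (by linarith)).1 hp
        refine (term_le hα hp.1).trans ?_
        have hl : 0 ≤ log p := log_natCast_nonneg _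
        have h2 : (0 : ℝ) < p := by exact_mod_cast hp.1.pos
        have h3 : (p : ℝ) ^ (-α) = p ^ (1 - α) / p := by
          rw [← rpow_sub_one h2.ne']
          ring_nf
        have h4 : (p : ℝ) ^ (1 - α) ≤ y ^ (1 - α) :=
          rpow_le_rpow h2.le hp.2 (by linarith)
        rw [h3, mul_assoc]
        calc kap⁻¹ * (log p * ((p : ℝ) ^ (1 - α) / p))
            ≤ kap⁻¹ * (log p * (y ^ (1 - α) / p)) := by gcongr
          _ = _ := by ring
    _ = kap⁻¹ * y ^ (1 - α) * ∑ p ∈ primesUpTo y, log p / p := by rw [mul_sum]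
    _ ≤ _ := by
        have := sum_log_div_le hy
        gcongr

lemma theta_mul_le_saddleSum {y α : ℝ} (hy : 1 ≤ y) (hα : 0 < α) :
    Chebyshev.theta y * y ^ (-α) ≤ saddleSum y α := by
  rw [← sum_log_primesUpTo, sum_mul]
  refine sum_le_sum fun p hp => ?_
  have hp := (mem_primesUpTo (by linarith)).1 hp
  have h2 : (1 : ℝ) < p := by exact_mod_cast hp.1.one_lt
  have hl : 0 ≤ log p := log_natCast_nonneg _
  have h3 : 1 < (p : ℝ) ^ α := one_lt_rpow h2 hα
  have h4 : (p : ℝ) ^ α ≤ y ^ α := rpow_le_rpow (by linarith) hp.2 hα.le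
  rw [rpow_neg (by linarith), ← div_eq_mul_inv]
  gcongr
  · linarith

lemma pos_of_saddleSum_pos {y α : ℝ} (hy : 0 ≤ y) (h : 0 < saddleSum y α) : 0 < α := by
  by_contra! hα
  refine absurd h (not_lt.2 (sum_nonpos fun p hp => ?_))
  have hp := (mem_primesUpTo hy).1 hp
  have h2 : (1 : ℝ) ≤ p := by exact_mod_cast hp.1.one_lt.le
  exact div_nonpos_of_nonneg_of_nonpos (log_natCast_nonneg _)
    (by linarith [rpow_le_one_of_one_le_of_nonpos h2 hα])

lemma exists_alpha_bounds : ∃ y₀ : ℝ, ∀ x y α : ℝ, y₀ ≤ y → 3 ≤ x → log x ^ (1.1 : ℝ) ≤ y →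
    y ≤ x ^ ((1 : ℝ) / 3) → saddleSum y α = log x → 1 / 20 ≤ α ∧ α ≤ 1 := by
  obtain ⟨c, hc, hc1, hθ⟩ := exists_theta_lower
  refine ⟨max 17 ((1 / c) ^ ((220 : ℝ) / 9) + 1), fun x y α hy hx hxy hyx hα => ?_⟩
  have hy1 : 17 ≤ y := (le_max_left _ _).trans hy
  have hy2 : (1 / c) ^ ((220 : ℝ) / 9) + 1 ≤ y := (le_max_right _ _).trans hy
  have hlx : 0 < log x := log_pos (by linarith)
  have hα0 : 0 < α := pos_of_saddleSum_pos (y := y) (by linarith) (by rw [hα]; exact hlx)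
  have hly : 3 * log y ≤ log x := by
    have := log_le_log (by linarith) hyx
    rw [log_rpow (by linarith)] at this
    linarith
  constructor
  · by_contra! hlt
    have h1 := theta_mul_le_saddleSum (y := y) (by linarith) hα0
    have h2 := hθ y (by linarith)
    rw [hα] at h1
    have hyp : 0 < y := by linarith
    have h3 : log x ≤ y ^ ((10 : ℝ) / 11) := by
      calc log x = (log x ^ (1.1 : ℝ)) ^ ((10 : ℝ) / 11) := by
            rw [← rpow_mul hlx.le]; norm_num
        _ ≤ _ := by gcongr
    have h4 : c * y ^ (1 - α) ≤ y ^ ((10 : ℝ) / 11) := by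
      calc c * y ^ (1 - α) = c * y * y ^ (-α) := by
            rw [sub_eq_add_neg, rpow_add hyp, rpow_one]; ring
        _ ≤ Chebyshev.theta y * y ^ (-α) := by gcongr
        _ ≤ _ := h1.trans h3
    have h5 : y ^ ((10 : ℝ) / 11) * y ^ ((9 : ℝ) / 220) ≤ y ^ (1 - α) := by
      rw [← rpow_add hyp]
      exact rpow_le_rpow_of_exponent_le (by linarith) (by linarith)
    have h6 : 1 / c < y ^ ((9 : ℝ) / 220) := by
      calc 1 / c = ((1 / c) ^ ((220 : ℝ) / 9)) ^ ((9 : ℝ) / 220) := by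
            rw [← rpow_mul (by positivity)]; norm_num
        _ < _ := by
          apply rpow_lt_rpow (by positivity) (by linarith) (by norm_num)
    have h7 : 0 < y ^ ((10 : ℝ) / 11) := by positivity
    rw [div_lt_iff₀ hc] at h6
    nlinarith
  · by_contra! hlt
    have h1 : saddleSum y α ≤ 2 * ∑ p ∈ primesUpTo y, log p / p := by
      rw [mul_sum]
      refine sum_le_sum fun p hp => ?_
      have hp := (mem_primesUpTo (by linarith)).1 hp
      have h2 : (2 : ℝ) ≤ p := by exact_mod_cast hp.1.two_le
      have hl : 0 ≤ log p := log_natCast_nonneg _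
      have h3 : (p : ℝ) ≤ (p : ℝ) ^ α := by
        conv_lhs => rw [← rpow_one (p : ℝ)]
        exact rpow_le_rpow_of_exponent_le (by linarith) hlt.le
      calc log p / ((p : ℝ) ^ α - 1) ≤ log p / ((p : ℝ) / 2) := by
            gcongr
            linarith
        _ = _ := by ring
    have h2 := sum_log_div_le (y := y) (by linarith)
    have h3 : 2 * log 4 < log y := by
      rw [show (2 : ℝ) * log 4 = log (4 ^ 2) by rw [log_pow]; norm_num]
      exact log_lt_log (by norm_num) (by linarith)
    linarith

/-- `B` is large enough that `θ` satisfies Chebyshev bounds on `B`-adic blocks. -/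
structure IsBlockBase (B : ℕ) (c : ℝ) : Prop where
  three_le : 3 ≤ B
  c_pos : 0 < c
  c_le_one : c ≤ 1
  block : ∀ k : ℕ, 1 ≤ k →
    c * (B : ℝ) ^ k ≤ Chebyshev.theta ((B : ℝ) ^ k) - Chebyshev.theta ((B : ℝ) ^ (k - 1))

/-- The number of `B`-adic blocks below `y`. -/
def numBlocks (B : ℕ) (y : ℝ) : ℕ := Nat.log B ⌊y⌋₊

/-- The weighted sum of `Ψ` over `B`-adic scales. -/
def blockSum (B : ℕ) (y Y : ℝ) : ℝ :=
  ∑ k ∈ range (numBlocks B y + 1), (B : ℝ) ^ k * Psi (Y / (B : ℝ) ^ k) y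

lemma pow_numBlocks_le (B : ℕ) {y : ℝ} (hy : 1 ≤ y) : (B : ℝ) ^ numBlocks B y ≤ y := by
  have h1 : ⌊y⌋₊ ≠ 0 := by
    have : 1 ≤ ⌊y⌋₊ := Nat.le_floor (by simpa using hy)
    omega
  have h : B ^ numBlocks B y ≤ ⌊y⌋₊ := Nat.pow_log_le_self B h1
  calc (B : ℝ) ^ numBlocks B y ≤ (⌊y⌋₊ : ℝ) := by exact_mod_cast h
    _ ≤ y := Nat.floor_le (by linarith)

lemma lt_pow_numBlocks_succ {B : ℕ} (hB : 1 < B) (y : ℝ) :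
    y < (B : ℝ) ^ (numBlocks B y + 1) := by
  have h : ⌊y⌋₊ < B ^ (numBlocks B y + 1) := Nat.lt_pow_succ_log_self hB _
  have h2 : ⌊y⌋₊ + 1 ≤ B ^ (numBlocks B y + 1) := h
  calc y < (⌊y⌋₊ : ℝ) + 1 := Nat.lt_floor_add_one y
    _ ≤ _ := by exact_mod_cast h2

lemma saddleSum_le_geom {B : ℕ} (hB : 1 < B) {y α : ℝ} (hy : 1 ≤ y) (hα : 1 / 20 ≤ α) :
    saddleSum y α ≤ kap⁻¹ * log 4 * B *
      ∑ k ∈ range (numBlocks B y + 1), ((B : ℝ) ^ (1 - α)) ^ k := by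
  have hk := kap_pos
  have hB0 : (0 : ℝ) < B := by exact_mod_cast (by omega : 0 < B)
  have hmaps : ∀ p ∈ primesUpTo y, Nat.log B p ∈ range (numBlocks B y + 1) := by
    intro p hp
    have hp := (mem_primesUpTo (by linarith)).1 hp
    rw [mem_range, Nat.lt_succ_iff]
    exact Nat.log_mono_right (Nat.le_floor hp.2)
  rw [saddleSum, ← sum_fiberwise_of_maps_to hmaps, mul_sum]
  refine sum_le_sum fun k _ => ?_
  have hterm : ∀ p ∈ (primesUpTo y).filter (fun p => Nat.log B p = k),
      log p / ((p : ℝ) ^ α - 1) ≤ kap⁻¹ * ((B : ℝ) ^ (-α)) ^ k * log p := by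
    intro p hp
    rw [mem_filter] at hp
    have hpp := (mem_primesUpTo (by linarith)).1 hp.1
    refine (term_le hα hpp.1).trans ?_
    have hl : 0 ≤ log p := log_natCast_nonneg _
    have h1 : B ^ k ≤ p := by rw [← hp.2]; exact Nat.pow_log_le_self B hpp.1.pos.ne'
    have h2 : (B : ℝ) ^ k ≤ p := by exact_mod_cast h1
    have h3 : (p : ℝ) ^ (-α) ≤ ((B : ℝ) ^ (-α)) ^ k := by
      calc (p : ℝ) ^ (-α) ≤ ((B : ℝ) ^ k) ^ (-α) :=
            rpow_le_rpow_of_nonpos (by positivity) h2 (by linarith)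
        _ = _ := by rw [← rpow_natCast, ← rpow_mul hB0.le, ← rpow_natCast, ← rpow_mul hB0.le,
                    mul_comm]
    calc kap⁻¹ * (log p * (p : ℝ) ^ (-α)) ≤ kap⁻¹ * (log p * ((B : ℝ) ^ (-α)) ^ k) := by gcongr
      _ = _ := by ring
  refine (sum_le_sum hterm).trans ?_
  rw [← mul_sum]
  have hth : ∑ p ∈ (primesUpTo y).filter (fun p => Nat.log B p = k), log p ≤
      log 4 * (B : ℝ) ^ (k + 1) := by
    calc _ ≤ ∑ p ∈ primesUpTo ((B : ℝ) ^ (k + 1)), log p := by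
          refine sum_le_sum_of_subset_of_nonneg ?_ fun p _ _ => log_natCast_nonneg _
          intro p hp
          rw [mem_filter] at hp
          have hpp := (mem_primesUpTo (by linarith)).1 hp.1
          refine (mem_primesUpTo (by positivity)).2 ⟨hpp.1, ?_⟩
          have : p < B ^ (Nat.log B p + 1) := Nat.lt_pow_succ_log_self hB p
          rw [hp.2] at this
          exact_mod_cast this.le
      _ ≤ _ := by
          rw [sum_log_primesUpTo]
          exact Chebyshev.theta_le_log4_mul_x (by positivity)
  calc kap⁻¹ * ((B : ℝ) ^ (-α)) ^ k *
        ∑ p ∈ (primesUpTo y).filter (fun p => Nat.log B p = k), log p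
      ≤ kap⁻¹ * ((B : ℝ) ^ (-α)) ^ k * (log 4 * (B : ℝ) ^ (k + 1)) := by gcongr
    _ = kap⁻¹ * log 4 * B * ((B : ℝ) ^ (-α) * B) ^ k := by rw [mul_pow]; ring
    _ = _ := by
      congr 2
      rw [sub_eq_add_neg, rpow_add hB0, rpow_one, mul_comm]

/-- The averaged lower bound for `Ψ(Y, y)` by its values at smaller scales. -/
lemma blockSum_le {B : ℕ} {c : ℝ} (hB : IsBlockBase B c) {y Y μ : ℝ} (hy : 1 ≤ y)
    (hμ : 1 ≤ μ) (hY : log Y ≤ μ) (hY0 : 0 < Y) :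
    c / 2 * blockSum B y Y ≤ μ * Psi Y y := by
  have hB1 : 1 < B := by have := hB.three_le; omega
  have hB0 : (1 : ℝ) ≤ B := by exact_mod_cast hB1.le
  have hc := hB.c_pos
  rcases lt_or_ge Y 1 with h | h
  · have : blockSum B y Y = 0 := by
      refine sum_eq_zero fun k _ => ?_
      rw [Psi_eq_zero y]
      · simp
      · exact (div_le_self hY0.le (one_le_pow₀ hB0)).trans_lt h
    rw [this]
    have : (0 : ℝ) ≤ μ * Psi Y y := by positivity
    linarith
  have h1 := sum_log_mul_Psi_le (Y := Y) (y := y) (by linarith) (fun _ => 1)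
  rw [sum_sigma] at h1
  simp only [Icc_self, sum_singleton, pow_one] at h1
  have h2 : log Y * Psi Y y ≤ μ * Psi Y y := by gcongr
  set K := numBlocks B y with hK
  have h3 : ∑ k ∈ Icc 1 K, c * (B : ℝ) ^ k * Psi (Y / (B : ℝ) ^ k) y ≤
      ∑ p ∈ primesUpTo y, log p * Psi (Y / p) y := by
    have hsub : (primesUpTo y).filter (fun p => Nat.clog B p ∈ Icc 1 K) ⊆ primesUpTo y :=
      filter_subset _ _
    refine le_trans ?_ (sum_le_sum_of_subset_of_nonneg hsub fun p _ _ => by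
      have := log_natCast_nonneg p
      positivity)
    rw [← sum_fiberwise_of_maps_to
      (s := (primesUpTo y).filter (fun p => Nat.clog B p ∈ Icc 1 K)) (t := Icc 1 K)
      (g := fun p => Nat.clog B p) (fun p hp => (mem_filter.1 hp).2)]
    refine sum_le_sum fun k hk => ?_
    have hk1 := (mem_Icc.1 hk).1
    have hkK := (mem_Icc.1 hk).2
    have hset : primesUpTo ((B : ℝ) ^ k) \ primesUpTo ((B : ℝ) ^ (k - 1)) ⊆
        ((primesUpTo y).filter (fun p => Nat.clog B p ∈ Icc 1 K)).filter
          (fun p => Nat.clog B p = k) := by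
      intro p hp
      rw [mem_sdiff, mem_primesUpTo (by positivity), mem_primesUpTo (by positivity)] at hp
      obtain ⟨⟨hp1, hp2⟩, hp3⟩ := hp
      have hp4 : (B : ℝ) ^ (k - 1) < p := by
        by_contra! hcon
        exact hp3 ⟨hp1, hcon⟩
      have hcl : Nat.clog B p = k := by
        refine le_antisymm ?_ ?_
        · exact (Nat.clog_le_iff_le_pow hB1).2 (by exact_mod_cast hp2)
        · have : k - 1 < Nat.clog B p := (Nat.lt_clog_iff_pow_lt hB1).2 (by exact_mod_cast hp4)
          omega
      rw [mem_filter, mem_filter, mem_primesUpTo (by linarith)]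
      refine ⟨⟨⟨hp1, ?_⟩, by rw [hcl]; exact hk⟩, hcl⟩
      calc (p : ℝ) ≤ (B : ℝ) ^ k := hp2
        _ ≤ (B : ℝ) ^ K := by gcongr
        _ ≤ y := pow_numBlocks_le B hy
    refine le_trans ?_ (sum_le_sum_of_subset_of_nonneg hset fun p _ _ => by
      have := log_natCast_nonneg p
      positivity)
    have hsub2 : primesUpTo ((B : ℝ) ^ (k - 1)) ⊆ primesUpTo ((B : ℝ) ^ k) := by
      intro p hp
      rw [mem_primesUpTo (by positivity)] at hp ⊢
      exact ⟨hp.1, hp.2.trans (pow_le_pow_right₀ hB0 (by omega))⟩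
    have hblock : c * (B : ℝ) ^ k ≤
        ∑ p ∈ primesUpTo ((B : ℝ) ^ k) \ primesUpTo ((B : ℝ) ^ (k - 1)), log p := by
      have h := sum_sdiff (f := fun p : ℕ => log p) hsub2
      rw [sum_log_primesUpTo, sum_log_primesUpTo] at h
      have := hB.block k hk1
      linarith
    calc c * (B : ℝ) ^ k * Psi (Y / (B : ℝ) ^ k) y
        ≤ (∑ p ∈ primesUpTo ((B : ℝ) ^ k) \ primesUpTo ((B : ℝ) ^ (k - 1)), log p) *
          Psi (Y / (B : ℝ) ^ k) y := by gcongr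
      _ ≤ _ := by
        rw [sum_mul]
        refine sum_le_sum fun p hp => ?_
        rw [mem_sdiff, mem_primesUpTo (by positivity)] at hp
        have h0 := log_natCast_nonneg p
        have hp0 : (0 : ℝ) < p := by exact_mod_cast hp.1.1.pos
        have : (Psi (Y / (B : ℝ) ^ k) y : ℝ) ≤ Psi (Y / p) y := by
          apply Psi_mono_real
          have := hp.1.2
          gcongr
        gcongr
  have h4 : blockSum B y Y = Psi Y y + ∑ k ∈ Icc 1 K, (B : ℝ) ^ k * Psi (Y / (B : ℝ) ^ k) y := by
    rw [blockSum, sum_range_succ', add_comm]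
    congr 1
    · simp
    · rw [range_eq_Ico, sum_Ico_add' (fun k => (B : ℝ) ^ k * (Psi (Y / (B : ℝ) ^ k) y : ℝ)) 0 K 1]
      rfl
  have h5 : ∑ k ∈ Icc 1 K, c * (B : ℝ) ^ k * Psi (Y / (B : ℝ) ^ k) y =
      c * ∑ k ∈ Icc 1 K, (B : ℝ) ^ k * Psi (Y / (B : ℝ) ^ k) y := by
    rw [mul_sum]
    exact sum_congr rfl fun _ _ => by ring
  have h6 : c * (Psi Y y : ℝ) ≤ μ * Psi Y y := by
    have := hB.c_le_one
    gcongr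
    linarith
  rw [h4]
  linarith

lemma truncated_sum_ge {y α V : ℝ} (hy : 1 ≤ y) (hα : 1 / 20 ≤ α) (hV : 1 ≤ V) :
    saddleSum y α - Chebyshev.theta y * V ^ (-α) * kap⁻¹ ≤
      ∑ t ∈ (primesUpTo y).sigma (fun p => Icc 1 (Nat.log p ⌊V⌋₊)),
        log t.1 * ((t.1 ^ t.2 : ℕ) : ℝ) ^ (-α) := by
  rw [sum_sigma, saddleSum, ← sum_log_primesUpTo, sum_mul, sum_mul, ← sum_sub_distrib]
  refine sum_le_sum fun p hp => ?_
  have hp := (mem_primesUpTo (by linarith)).1 hp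
  have h2 : (2 : ℝ) ≤ p := by exact_mod_cast hp.1.two_le
  have hp0 : (0 : ℝ) < p := by linarith
  have hl : 0 ≤ log p := log_natCast_nonneg _
  set w := (p : ℝ) ^ (-α) with hw
  have hw0 : 0 < w := rpow_pos_of_pos hp0 _
  have hw1 : kap ≤ 1 - w := kap_le_one_sub hα h2
  have hk := kap_pos
  have hpw : (p : ℝ) ^ α * w = 1 := by
    rw [hw, ← rpow_add hp0]; simp
  set a := Nat.log p ⌊V⌋₊ with ha
  have hpow : ∀ k : ℕ, ((p ^ k : ℕ) : ℝ) ^ (-α) = w ^ k := by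
    intro k
    rw [hw, Nat.cast_pow, ← rpow_natCast, ← rpow_mul hp0.le, ← rpow_natCast, ← rpow_mul hp0.le,
      mul_comm]
  have hsum : ∑ k ∈ Icc 1 a, log p * ((p ^ k : ℕ) : ℝ) ^ (-α) =
      log p * (w * (1 - w ^ a) / (1 - w)) := by
    simp only [hpow]
    rw [← mul_sum]
    congr 1
    have h := geom_sum_eq (x := w) (by linarith) a
    have h' : ∑ k ∈ Icc 1 a, w ^ k = w * ∑ k ∈ range a, w ^ k := by
      rw [mul_sum, range_eq_Ico]
      have := sum_Ico_add' (fun k => w ^ k) 0 a 1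
      rw [show Icc 1 a = Ico (0 + 1) (a + 1) from rfl, ← this]
      exact sum_congr rfl fun _ _ => by ring
    rw [h', h]
    have : w - 1 ≠ 0 := by linarith
    have : 1 - w ≠ 0 := by linarith
    field_simp
    ring
  have hterm : log p / ((p : ℝ) ^ α - 1) = log p * (w / (1 - w)) := by
    have h1 : (p : ℝ) ^ α - 1 = (1 - w) / w := by
      field_simp
      linarith
    rw [h1]
    field_simp
  have hVp : w ^ (a + 1) ≤ V ^ (-α) := by
    rw [← hpow]
    apply rpow_le_rpow_of_nonpos (by linarith) _ (by linarith)
    have h3 : ⌊V⌋₊ < p ^ (a + 1) := Nat.lt_pow_succ_log_self hp.1.one_lt _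
    have h4 : ⌊V⌋₊ + 1 ≤ p ^ (a + 1) := h3
    calc V ≤ (⌊V⌋₊ : ℝ) + 1 := (Nat.lt_floor_add_one V).le
      _ ≤ _ := by exact_mod_cast h4
  rw [hsum, hterm]
  have h5 : log p * (w / (1 - w)) - log p * (w * (1 - w ^ a) / (1 - w)) =
      log p * w ^ (a + 1) / (1 - w) := by
    have : 1 - w ≠ 0 := by linarith
    field_simp
    ring
  have h6 : log p * w ^ (a + 1) / (1 - w) ≤ log p * V ^ (-α) * kap⁻¹ := by
    rw [← div_eq_mul_inv]
    gcongr
  linarith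

lemma truncated_half_sum_ge {y α V : ℝ} (hy : 1 ≤ y) (hα : 0 < α) (hV : y ≤ V) :
    Chebyshev.theta y * y ^ (-α) ≤
      ∑ t ∈ (primesUpTo y).sigma (fun p => Icc 1 (Nat.log p ⌊V⌋₊)),
        log t.1 * ((t.1 ^ t.2 : ℕ) : ℝ) ^ (-α) := by
  rw [sum_sigma, ← sum_log_primesUpTo, sum_mul]
  refine sum_le_sum fun p hp => ?_
  have hp := (mem_primesUpTo (by linarith)).1 hp
  have hp0 : (0 : ℝ) < p := by exact_mod_cast hp.1.pos
  have hl : 0 ≤ log p := log_natCast_nonneg _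
  have h1 : 1 ≤ Nat.log p ⌊V⌋₊ := by
    apply Nat.log_pos hp.1.one_lt
    exact Nat.le_floor (hp.2.trans hV)
  refine le_trans ?_ (single_le_sum (f := fun k => log p * ((p ^ k : ℕ) : ℝ) ^ (-α))
    (fun k _ => by positivity) (mem_Icc.2 ⟨le_rfl, h1⟩))
  simp only [pow_one]
  have : y ^ (-α) ≤ (p : ℝ) ^ (-α) := rpow_le_rpow_of_nonpos hp0 hp.2 (by linarith)
  gcongr

lemma exists_log_le_rpow (C β : ℝ) (hβ : 0 < β) :
    ∃ y₀ : ℝ, 1 ≤ y₀ ∧ ∀ y, y₀ ≤ y → C * (log y + 2) ≤ y ^ β := by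
  have h := (isLittleO_log_rpow_atTop hβ).def (c := 1 / (2 * (|C| + 1))) (by positivity)
  have h2 : ∀ᶠ y : ℝ in Filter.atTop, 4 * (|C| + 1) ≤ y ^ β :=
    (tendsto_rpow_atTop hβ).eventually_ge_atTop _
  obtain ⟨y₀, hy₀⟩ := Filter.eventually_atTop.1 (h.and h2)
  refine ⟨max 1 y₀, le_max_left _ _, fun y hy => ?_⟩
  obtain ⟨h3, h4⟩ := hy₀ y ((le_max_right _ _).trans hy)
  have hy1 : 1 ≤ y := (le_max_left _ _).trans hy
  have hl : 0 ≤ log y := log_nonneg hy1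
  have hp : 0 ≤ y ^ β := by positivity
  rw [norm_of_nonneg hl, norm_of_nonneg hp, div_mul_eq_mul_div, one_mul,
    le_div_iff₀ (by positivity)] at h3
  have h5 : C * (log y + 2) ≤ (|C| + 1) * (log y + 2) := by
    have := le_abs_self C
    gcongr
    linarith
  linarith

lemma exists_saddle_half : ∃ y₀ : ℝ, 2 ≤ y₀ ∧ ∀ y α : ℝ, y₀ ≤ y → 1 / 20 ≤ α → α ≤ 1 →
    2 * saddleSum y α ≤ Chebyshev.theta y * y ^ (-(α / 2)) ∧ 2 * kap⁻¹ ≤ y ^ (α / 2) := by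
  obtain ⟨c, hc, hc1, hθ⟩ := exists_theta_lower
  have hk := kap_pos
  obtain ⟨y₁, hy₁, h⟩ := exists_log_le_rpow (2 * kap⁻¹ / c) (1 / 40) (by norm_num)
  refine ⟨max 2 y₁, le_max_left _ _, fun y α hy hα hα1 => ?_⟩
  have hy2 : 2 ≤ y := (le_max_left _ _).trans hy
  have h1 := h y ((le_max_right _ _).trans hy)
  have hy0 : 0 < y := by linarith
  have h2 : y ^ ((1 : ℝ) / 40) ≤ y ^ (α / 2) :=
    rpow_le_rpow_of_exponent_le (by linarith) (by linarith)
  have hl : 0 < log y := log_pos (by linarith)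
  have hl4 : log 4 ≤ 2 := by
    rw [show (4 : ℝ) = 2 ^ 2 by norm_num, log_pow]
    have := log_two_lt_d9
    push_cast
    linarith
  have h3 : 2 * kap⁻¹ * (log y + 2) ≤ c * y ^ (α / 2) := by
    have := h1.trans h2
    rw [div_mul_eq_mul_div, div_le_iff₀ hc] at this
    linarith
  constructor
  · have h4 := saddleSum_le_pow (y := y) (by linarith) hα hα1
    have h5 := hθ y hy2
    calc 2 * saddleSum y α ≤ 2 * (kap⁻¹ * y ^ (1 - α) * (log y + log 4)) := by linarith
      _ ≤ 2 * (kap⁻¹ * y ^ (1 - α) * (log y + 2)) := by gcongr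
      _ = y ^ (1 - α) * (2 * kap⁻¹ * (log y + 2)) := by ring
      _ ≤ y ^ (1 - α) * (c * y ^ (α / 2)) := by gcongr
      _ = c * (y ^ (1 : ℝ) * y ^ (-(α / 2))) := by
        rw [← rpow_add hy0, mul_left_comm, ← rpow_add hy0]
        ring_nf
      _ = c * y * y ^ (-(α / 2)) := by rw [rpow_one]; ring
      _ ≤ _ := by gcongr
  · have h6 : 2 * kap⁻¹ * 1 ≤ 2 * kap⁻¹ * (log y + 2) := by gcongr; linarith
    have h7 : c * y ^ (α / 2) ≤ 1 * y ^ (α / 2) := by gcongr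
    linarith

/-- A lower bound `Ψ(Z, y) ≥ A Z ^ α` on a window `[Y₁, Y₁ y ^ 2]` persists for larger `Z`, as long
as `log Z` does not exceed the saddle point sum. -/
lemma exists_propagation : ∃ y₀ : ℝ, 2 ≤ y₀ ∧ ∀ y α A Y₁ : ℝ, y₀ ≤ y → 1 / 20 ≤ α → α ≤ 1 →
    0 ≤ A → 0 < Y₁ → (∀ Z, Y₁ ≤ Z → Z ≤ Y₁ * y ^ 2 → A * Z ^ α ≤ Psi Z y) →
    ∀ Y, Y₁ ≤ Y → log Y ≤ saddleSum y α → A * (1 / 2) * Y ^ α ≤ Psi Y y := by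
  obtain ⟨y₀, hy₀, hhalf⟩ := exists_saddle_half
  refine ⟨y₀, hy₀, fun y α A Y₁ hy hα hα1 hA hY₁ hwin => ?_⟩
  obtain ⟨hs1, hs2⟩ := hhalf y α hy hα hα1
  have hy2 : 2 ≤ y := by linarith
  have hy0 : 0 < y := by linarith
  have hk := kap_pos
  have hθ := Chebyshev.theta_pos hy2
  have hf0 : 0 < saddleSum y α :=
    lt_of_lt_of_le (by positivity) (theta_mul_le_saddleSum (y := y) (by linarith) (by linarith))
  have key : ∀ n : ℕ, ∀ Y, Y₁ ≤ Y → Y ≤ Y₁ * y ^ 2 * 2 ^ n → log Y ≤ saddleSum y α →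
      A * (1 / 2 + 1 / 2 * (Y / Y₁) ^ (-(α / 2))) * Y ^ α ≤ Psi Y y := by
    intro n
    induction n with
    | zero =>
      intro Y hY hY' _
      have hY0 : 0 < Y := by linarith
      refine le_trans ?_ (hwin Y hY (by simpa using hY'))
      have : (Y / Y₁) ^ (-(α / 2)) ≤ 1 :=
        rpow_le_one_of_one_le_of_nonpos ((one_le_div hY₁).2 hY) (by linarith)
      have h3 : 0 ≤ Y ^ α := by positivity
      have : A * (1 / 2 + 1 / 2 * (Y / Y₁) ^ (-(α / 2))) ≤ A * 1 := by
        gcongr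
        linarith
      nlinarith
    | succ n ih =>
      intro Y hY hY' hlog
      have hY0 : 0 < Y := by linarith
      rcases le_total Y (Y₁ * y ^ 2 * 2 ^ n) with h | h
      · exact ih Y hY h hlog
      set V := Y / Y₁ with hV
      have hYV : Y = V * Y₁ := by rw [hV]; field_simp
      have hVy : y ^ 2 ≤ V := by
        rw [hV, le_div_iff₀ hY₁]
        have : (1 : ℝ) ≤ 2 ^ n := one_le_pow₀ (by norm_num)
        have h' : 0 < Y₁ * y ^ 2 := by positivity
        nlinarith
      have hV1 : 1 ≤ V := by nlinarith
      have hV0 : 0 < V := by linarith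
      have hVy1 : y ≤ V := by nlinarith
      set T := (primesUpTo y).sigma (fun p => Icc 1 (Nat.log p ⌊V⌋₊)) with hT
      have h1 := sum_log_mul_Psi_le (Y := Y) (y := y) hy0.le (fun p => Nat.log p ⌊V⌋₊)
      have h2 : ∀ t ∈ T, log t.1 * (A * Y ^ α / 2 * (((t.1 ^ t.2 : ℕ) : ℝ) ^ (-α) +
          V ^ (-(α / 2)) * ((t.1 ^ t.2 : ℕ) : ℝ) ^ (-(α / 2)))) ≤
          log t.1 * Psi (Y / (t.1 ^ t.2 : ℕ)) y := by
        intro t ht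
        rw [hT, mem_sigma, mem_Icc, mem_primesUpTo hy0.le] at ht
        obtain ⟨⟨hp, hpy⟩, ha1, ha⟩ := ht
        have hl : 0 ≤ log t.1 := log_natCast_nonneg _
        set m := t.1 ^ t.2 with hm
        have hm2 : 2 ≤ m := by
          calc 2 ≤ t.1 := hp.two_le
            _ = t.1 ^ 1 := (pow_one _).symm
            _ ≤ m := Nat.pow_le_pow_right hp.pos ha1
        have hm2' : (2 : ℝ) ≤ m := by exact_mod_cast hm2
        have hm0 : (0 : ℝ) < m := by linarith
        have hmV : (m : ℝ) ≤ V := by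
          have : m ≤ ⌊V⌋₊ := Nat.pow_le_of_le_log (by
            have : 1 ≤ ⌊V⌋₊ := Nat.le_floor (by simpa using hV1)
            omega) ha
          exact (Nat.le_floor_iff hV0.le).1 this
        have h3 := ih (Y / m) (by rw [le_div_iff₀ hm0, hYV, mul_comm]; gcongr) (by
            rw [div_le_iff₀ hm0]
            have : 0 < Y₁ * y ^ 2 * 2 ^ n := by positivity
            calc Y ≤ Y₁ * y ^ 2 * 2 ^ (n + 1) := hY'
              _ = Y₁ * y ^ 2 * 2 ^ n * 2 := by ring
              _ ≤ _ := by gcongr)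
          ((log_le_log (by positivity) (div_le_self hY0.le (by linarith))).trans hlog)
        have h4 : A * (1 / 2 + 1 / 2 * (Y / m / Y₁) ^ (-(α / 2))) * (Y / m) ^ α =
            A * Y ^ α / 2 * ((m : ℝ) ^ (-α) + V ^ (-(α / 2)) * (m : ℝ) ^ (-(α / 2))) := by
          rw [show Y / m / Y₁ = V / m by rw [hV]; ring, div_rpow hV0.le hm0.le,
            div_rpow hY0.le hm0.le]
          have h5 : (m : ℝ) ^ (-α) = 1 / (m : ℝ) ^ α := by
            rw [rpow_neg hm0.le, one_div]
          have h6 : (m : ℝ) ^ (-(α / 2)) * (m : ℝ) ^ (-(α / 2)) = 1 / (m : ℝ) ^ α := by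
            rw [← rpow_add hm0, ← h5]; ring_nf
          have h7 : 0 < (m : ℝ) ^ (-(α / 2)) := by positivity
          have h8 : 0 < (m : ℝ) ^ α := by positivity
          rw [h5]
          field_simp at h6 ⊢
          linear_combination (-(A * V ^ (-(α / 2)))) * h6
        rw [h4] at h3
        gcongr
      have h9 := (sum_le_sum h2).trans h1
      have h10 : ∑ t ∈ T, log t.1 * (A * Y ^ α / 2 * (((t.1 ^ t.2 : ℕ) : ℝ) ^ (-α) +
          V ^ (-(α / 2)) * ((t.1 ^ t.2 : ℕ) : ℝ) ^ (-(α / 2)))) =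
          A * Y ^ α / 2 * (∑ t ∈ T, log t.1 * ((t.1 ^ t.2 : ℕ) : ℝ) ^ (-α) +
            V ^ (-(α / 2)) * ∑ t ∈ T, log t.1 * ((t.1 ^ t.2 : ℕ) : ℝ) ^ (-(α / 2))) := by
        rw [mul_sum, ← sum_add_distrib, mul_sum]
        exact sum_congr rfl fun _ _ => by ring
      rw [h10] at h9
      have h11 := truncated_sum_ge (y := y) (V := V) (by linarith) hα hV1
      have h12 := truncated_half_sum_ge (y := y) (α := α / 2) (V := V) (by linarith)
        (by linarith) hVy1
      set W := V ^ (-(α / 2)) with hW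
      have hW0 : 0 < W := by positivity
      have hWW : V ^ (-α) = W * W := by
        rw [hW, ← rpow_add hV0]; ring_nf
      have hWy : W * (2 * kap⁻¹) ≤ y ^ (-(α / 2)) := by
        have h13 : W ≤ (y ^ 2) ^ (-(α / 2)) :=
          rpow_le_rpow_of_nonpos (by positivity) hVy (by linarith)
        have h14 : (y ^ 2) ^ (-(α / 2)) = y ^ (-(α / 2)) * y ^ (-(α / 2)) := by
          rw [sq, mul_rpow hy0.le hy0.le]
        have h15 : y ^ (-(α / 2)) * y ^ (α / 2) = 1 := by
          rw [← rpow_add hy0]; simp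
        calc W * (2 * kap⁻¹) ≤ y ^ (-(α / 2)) * y ^ (-(α / 2)) * y ^ (α / 2) := by
              rw [h14] at h13
              gcongr
          _ = _ := by rw [mul_assoc, h15, mul_one]
      rw [hWW] at h11
      have h16 : saddleSum y α * (1 + W) ≤
          ∑ t ∈ T, log t.1 * ((t.1 ^ t.2 : ℕ) : ℝ) ^ (-α) +
            W * ∑ t ∈ T, log t.1 * ((t.1 ^ t.2 : ℕ) : ℝ) ^ (-(α / 2)) := by
        have h17 : W * (Chebyshev.theta y * y ^ (-(α / 2))) ≤
          W * ∑ t ∈ T, log t.1 * ((t.1 ^ t.2 : ℕ) : ℝ) ^ (-(α / 2)) := by gcongr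
        have h18 : Chebyshev.theta y * (W * W) * kap⁻¹ ≤
            W * (Chebyshev.theta y * y ^ (-(α / 2))) / 2 := by
          have : W * Chebyshev.theta y * (W * (2 * kap⁻¹)) ≤
            W * Chebyshev.theta y * y ^ (-(α / 2)) := by gcongr
          linarith
        have h19 : W * (2 * saddleSum y α) ≤ W * (Chebyshev.theta y * y ^ (-(α / 2))) := by
          gcongr
        linarith
      have h20 : A * Y ^ α / 2 * (saddleSum y α * (1 + W)) ≤ saddleSum y α * Psi Y y := by
        have h21 : log Y * Psi Y y ≤ saddleSum y α * Psi Y y := by gcongr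
        refine le_trans ?_ (h9.trans h21)
        gcongr
      refine le_of_mul_le_mul_left ?_ hf0
      calc _ = A * Y ^ α / 2 * (saddleSum y α * (1 + W)) := by ring
        _ ≤ _ := h20
  intro Y hY hlog
  have hY0 : 0 < Y := by linarith
  obtain ⟨n, hn⟩ := pow_unbounded_of_one_lt (Y / (Y₁ * y ^ 2)) (show (1 : ℝ) < 2 by norm_num)
  rw [div_lt_iff₀ (by positivity)] at hn
  refine le_trans ?_ (key n Y hY (by linarith) hlog)
  have : 0 ≤ (Y / Y₁) ^ (-(α / 2)) := by positivity
  gcongr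
  linarith

/-- If each term of a nonnegative sequence dominates the average of the previous `K` terms, then
the first block of terms is bounded below by the previous block. -/
lemma block_lower_bound {H : ℤ → ℝ} (hH : ∀ i, 0 ≤ H i) {K : ℕ} {I : ℤ} {c μ D ρ : ℝ}
    (hc : 0 < c) (hc1 : c ≤ 1) (hK : 1 ≤ K) (hKμ : K ≤ μ) (hρ : 1 ≤ ρ) (hD : 1 ≤ D)
    (hrec : ∀ i ≤ I, c * ∑ j ∈ Icc (i - K) i, H j ≤ μ * H i)
    (hμ : μ ≤ D * ∑ k ∈ range (K + 1), ρ ^ k) {v : ℕ} (hv : v ≤ K) (hvI : (v : ℤ) ≤ I) :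
    c ^ 3 / (48 * D) * (K / μ ^ 2) * ∑ j ∈ Icc (-(K : ℤ)) 0, H j ≤ ρ ^ v * H v := by
  have hK1 : (1 : ℝ) ≤ K := by exact_mod_cast hK
  have hμ0 : 0 < μ := by linarith
  set Φ := ∑ j ∈ Icc (-(K : ℤ)) 0, H j with hΦ
  have hΦ0 : 0 ≤ Φ := sum_nonneg fun j _ => hH j
  set e := c / μ with he
  have he0 : 0 < e := by positivity
  have heK : e * K ≤ 1 := by
    rw [he, div_mul_eq_mul_div, div_le_one hμ0]
    nlinarith
  have hstep : ∀ i ≤ I, ∀ a b : ℤ, i - K ≤ a → b ≤ i → e * ∑ j ∈ Icc a b, H j ≤ H i := by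
    intro i hi a b ha hb
    have h1 : ∑ j ∈ Icc a b, H j ≤ ∑ j ∈ Icc (i - K) i, H j :=
      sum_le_sum_of_subset_of_nonneg (Icc_subset_Icc ha hb) fun j _ _ => hH j
    have h2 := hrec i hi
    rw [he, div_mul_eq_mul_div, div_le_iff₀ hμ0]
    nlinarith
  have hconst : ∀ i ≤ I, ∀ a b : ℤ, i - K ≤ a → b ≤ i → ∀ (m : ℕ) (t : ℝ), (m : ℤ) ≤ b + 1 - a →
      0 ≤ t → (∀ j, a ≤ j → j ≤ b → t ≤ H j) → e * (m * t) ≤ H i := by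
    intro i hi a b ha hb m t hm ht h
    refine le_trans ?_ (hstep i hi a b ha hb)
    have h1 : ((Icc a b).card : ℝ) * t ≤ ∑ j ∈ Icc a b, H j := by
      rw [← nsmul_eq_mul]
      exact card_nsmul_le_sum _ _ _ fun j hj => h j (mem_Icc.1 hj).1 (mem_Icc.1 hj).2
    have h2 : (m : ℝ) ≤ (Icc a b).card := by
      rw [Int.card_Icc]
      exact_mod_cast (by omega : m ≤ (b + 1 - a).toNat)
    have h3 : (m : ℝ) * t ≤ ((Icc a b).card : ℝ) * t := by gcongr
    gcongr
    exact h3.trans h1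
  have hρv : ∀ n : ℕ, (1 : ℝ) ≤ ρ ^ n := fun n => one_le_pow₀ hρ
  set h := K / 2 with hh
  have hhK : 2 * h ≤ K := by omega
  have hhK2 : K ≤ 2 * h + 1 := by omega
  have hhR : (K : ℝ) ≤ 2 * (h : ℝ) + 1 := by exact_mod_cast hhK2
  have htarget : c ^ 3 / (48 * D) * (K / μ ^ 2) * Φ ≤ e ^ 2 * K * Φ / 4 := by
    have h1 : c ^ 3 / (48 * D) ≤ c ^ 2 / 4 := by
      rw [div_le_div_iff₀ (by positivity) (by norm_num)]
      have : c ^ 3 ≤ c ^ 2 := pow_le_pow_of_le_one hc.le hc1 (by norm_num)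
      nlinarith [sq_nonneg c]
    calc c ^ 3 / (48 * D) * (K / μ ^ 2) * Φ ≤ c ^ 2 / 4 * (K / μ ^ 2) * Φ := by gcongr
      _ = _ := by rw [he]; ring
  have hsplit : Φ = ∑ j ∈ Icc (-(K : ℤ)) (-(h : ℤ) - 1), H j + ∑ j ∈ Icc (-(h : ℤ)) 0, H j := by
    rw [hΦ, ← sum_union]
    · congr 1
      ext j
      simp only [mem_union, mem_Icc]
      omega
    · rw [disjoint_left]
      intro j
      simp only [mem_Icc]
      omega
  rcases le_total (Φ / 2) (∑ j ∈ Icc (-(h : ℤ)) 0, H j) with hcase | hcase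
  · have h1 : ∀ i : ℤ, 0 ≤ i → i ≤ v → i ≤ K - h → e * (Φ / 2) ≤ H i := by
      intro i hi hiv hiK
      refine le_trans ?_ (hstep i (by omega) (-h) 0 (by omega) hi)
      gcongr
    have h2 : e ^ 2 * K * Φ / 4 ≤ H v := by
      rcases le_total v (K - h) with hvK | hvK
      · refine le_trans ?_ (h1 v (by omega) le_rfl (by omega))
        have : e * K * (e * Φ) ≤ 1 * (e * Φ) := by gcongr
        nlinarith [mul_nonneg he0.le hΦ0]
      · refine le_trans ?_ (hconst v hvI 0 (K - h) (by omega) (by omega) (K - h + 1)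
          (e * (Φ / 2)) (by omega) (by positivity) fun j hj1 hj2 => h1 j hj1 (by omega) hj2)
        have h3 : (K : ℝ) / 2 ≤ ((K - h + 1 : ℕ) : ℝ) := by
          have : K ≤ 2 * (K - h + 1) := by omega
          have : (K : ℝ) ≤ 2 * ((K - h + 1 : ℕ) : ℝ) := by exact_mod_cast this
          linarith
        calc e ^ 2 * K * Φ / 4 = e * ((K / 2 : ℝ) * (e * (Φ / 2))) := by ring
          _ ≤ _ := by gcongr
    calc _ ≤ e ^ 2 * K * Φ / 4 := htarget
      _ ≤ H v := h2
      _ ≤ ρ ^ v * H v := le_mul_of_one_le_left (hH _) (hρv v)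
  · have hcase2 : Φ / 2 ≤ ∑ j ∈ Icc (-(K : ℤ)) (-(h : ℤ) - 1), H j := by linarith
    have h1 : ∀ i : ℤ, -h - 1 ≤ i → i ≤ 0 → e * (Φ / 2) ≤ H i := by
      intro i hi hi0
      refine le_trans ?_ (hstep i (by omega) (-K) (-h - 1) (by omega) (by omega))
      gcongr
    have h2 : ∀ i : ℤ, 0 ≤ i → i ≤ v → i ≤ K - h - 1 → e ^ 2 * K * Φ / 4 ≤ H i := by
      intro i hi hiv hiK
      refine le_trans ?_ (hconst i (by omega) (-h - 1) 0 (by omega) hi (h + 2)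
          (e * (Φ / 2)) (by push_cast; omega) (by positivity) fun j hj1 hj2 => h1 j hj1 hj2)
      push_cast
      calc e ^ 2 * K * Φ / 4 = e * ((K / 2 : ℝ) * (e * (Φ / 2))) := by ring
        _ ≤ _ := by gcongr; linarith
    rcases le_or_gt v (K - h - 1) with hvK | hvK
    · calc _ ≤ e ^ 2 * K * Φ / 4 := htarget
        _ ≤ H v := h2 v (by omega) le_rfl (by omega)
        _ ≤ ρ ^ v * H v := le_mul_of_one_le_left (hH _) (hρv v)
    · set τ := K - v with hτ
      have hvτ : v + τ = K := by omega
      have h3 : e * (((τ + 1 : ℕ) : ℝ) * (e * (Φ / 2))) ≤ H v :=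
        hconst v hvI (v - K) 0 (by omega) (by omega) (τ + 1) _ (by omega) (by positivity)
          fun j hj1 hj2 => h1 j (by omega) hj2
      have hvR : (K : ℝ) / 2 ≤ v := by
        have : K ≤ 2 * v := by omega
        have : (K : ℝ) ≤ 2 * v := by exact_mod_cast this
        linarith
      rcases le_total 1 (((τ + 1 : ℕ) : ℝ) * (ρ - 1)) with hτρ | hτρ
      · have h4 : (K : ℝ) / 2 ≤ ρ ^ v * ((τ + 1 : ℕ) : ℝ) := by
          have hb := one_add_mul_le_pow (a := ρ - 1) (by linarith) v
          rw [add_sub_cancel] at hb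
          have hτ0 : (0 : ℝ) ≤ ((τ + 1 : ℕ) : ℝ) := by positivity
          have h5 : (v : ℝ) * 1 ≤ v * (((τ + 1 : ℕ) : ℝ) * (ρ - 1)) := by gcongr
          nlinarith
        calc _ ≤ e ^ 2 * K * Φ / 4 := htarget
          _ = (K / 2 : ℝ) * (e * (e * (Φ / 2))) := by ring
          _ ≤ ρ ^ v * ((τ + 1 : ℕ) : ℝ) * (e * (e * (Φ / 2))) := by gcongr
          _ = ρ ^ v * (e * (((τ + 1 : ℕ) : ℝ) * (e * (Φ / 2)))) := by ring
          _ ≤ _ := by gcongr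
      · have h4 : e * (((K - h : ℕ) : ℝ) * (e ^ 2 * K * Φ / 4)) ≤ H v :=
          hconst v hvI 0 (K - h - 1) (by omega) (by omega) (K - h) _ (by omega) (by positivity)
            fun j hj1 hj2 => h2 j hj1 (by omega) hj2
        have h5 : (K : ℝ) / 2 ≤ ((K - h : ℕ) : ℝ) := by
          have : K ≤ 2 * (K - h) := by omega
          have : (K : ℝ) ≤ 2 * ((K - h : ℕ) : ℝ) := by exact_mod_cast this
          linarith
        have h6 : ρ ^ τ ≤ 3 := by
          calc ρ ^ τ ≤ ρ ^ (τ + 1) := pow_le_pow_right₀ hρ (by omega)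
            _ ≤ (exp (ρ - 1)) ^ (τ + 1) := by
              have := add_one_le_exp (ρ - 1)
              gcongr
              linarith
            _ = exp (((τ + 1 : ℕ) : ℝ) * (ρ - 1)) := (exp_nat_mul _ _).symm
            _ ≤ exp 1 := exp_le_exp.2 hτρ
            _ ≤ 3 := by linarith [exp_one_lt_d9]
        have h7 : μ ≤ 6 * D * K * ρ ^ v := by
          have h8 : ∑ k ∈ range (K + 1), ρ ^ k ≤ ((K + 1 : ℕ) : ℝ) * ρ ^ K := by
            have := sum_le_card_nsmul (range (K + 1)) (fun k => ρ ^ k) (ρ ^ K) fun k hk =>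
              pow_le_pow_right₀ hρ (by rw [mem_range] at hk; omega)
            simpa using this
          have h9 : ρ ^ K = ρ ^ v * ρ ^ τ := by rw [← pow_add, hvτ]
          have h10 : ((K + 1 : ℕ) : ℝ) ≤ 2 * K := by push_cast; linarith
          calc μ ≤ D * (((K + 1 : ℕ) : ℝ) * ρ ^ K) := hμ.trans (by gcongr)
            _ ≤ D * (2 * K * (ρ ^ v * 3)) := by
              rw [h9]
              have := hρv v
              gcongr
            _ = _ := by ring
        calc c ^ 3 / (48 * D) * (K / μ ^ 2) * Φ
            = c ^ 3 * K * Φ / (48 * D * μ ^ 3) * μ := by field_simp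
          _ ≤ c ^ 3 * K * Φ / (48 * D * μ ^ 3) * (6 * D * K * ρ ^ v) := by gcongr
          _ = ρ ^ v * (e * ((K / 2 : ℝ) * (e ^ 2 * K * Φ / 4))) := by
            rw [he]; field_simp; ring
          _ ≤ ρ ^ v * (e * (((K - h : ℕ) : ℝ) * (e ^ 2 * K * Φ / 4))) := by gcongr
          _ ≤ _ := by gcongr

/-- A lower bound on one block of `K + 1` terms extends to further blocks. -/
lemma block_extend {G : ℤ → ℝ} {K : ℕ} {I : ℤ} {c μ D ρ A : ℝ} (hG : ∀ i, 0 ≤ G i)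
    (hc : 0 < c) (hc1 : c ≤ 1) (hμ0 : 0 < μ) (hρ : 1 ≤ ρ) (hD : 1 ≤ D) (hA : 0 ≤ A)
    (hrec : ∀ i ≤ I, c * ∑ k ∈ range (K + 1), ρ ^ k * G (i - k) ≤ μ * G i)
    (hμ : μ ≤ D * ∑ k ∈ range (K + 1), ρ ^ k)
    (hbase : ∀ v : ℕ, v ≤ K → (v : ℤ) ≤ I → A ≤ G v) (n : ℕ) :
    ∀ v : ℕ, v ≤ K + n * (K / 2) → (v : ℤ) ≤ I → (c / (2 * D)) ^ n * A ≤ G v := by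
  have hr1 : c / (2 * D) ≤ 1 := by
    rw [div_le_one (by positivity)]
    linarith
  have hr0 : 0 < c / (2 * D) := by positivity
  induction n with
  | zero => intro v hv hvI; simpa using hbase v (by simpa using hv) hvI
  | succ n ih =>
    intro v hv hvI
    rcases le_or_gt v (K + n * (K / 2)) with hle | hlt
    · refine le_trans ?_ (ih v hle hvI)
      rw [pow_succ']
      have : 0 ≤ (c / (2 * D)) ^ n * A := by positivity
      nlinarith
    set h := K / 2 with hh
    set M := n * h with hM
    have hv' : v ≤ K + M + h := by rw [hM]; linarith
    have hhalf : ∑ k ∈ range (K + 1), ρ ^ k ≤ 2 * ∑ k ∈ Icc h K, ρ ^ k := by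
      have h1 : ∑ k ∈ range (K + 1), ρ ^ k = ∑ k ∈ range h, ρ ^ k + ∑ k ∈ Icc h K, ρ ^ k := by
        rw [← sum_union]
        · congr 1
          ext j
          simp only [mem_union, mem_Icc, mem_range]
          omega
        · rw [disjoint_left]
          intro j
          simp only [mem_Icc, mem_range]
          omega
      have h2 : ∑ k ∈ range h, ρ ^ k ≤ ∑ k ∈ Icc h K, ρ ^ k := by
        calc ∑ k ∈ range h, ρ ^ k ≤ ∑ k ∈ range h, ρ ^ (k + h) :=
              sum_le_sum fun k _ => pow_le_pow_right₀ hρ (by omega)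
          _ = ∑ k ∈ Ico (0 + h) (h + h), ρ ^ k := by
              rw [range_eq_Ico, sum_Ico_add' (fun k => ρ ^ k)]
          _ ≤ _ := by
              refine sum_le_sum_of_subset_of_nonneg ?_ fun k _ _ => by positivity
              intro k
              simp only [mem_Ico, mem_Icc]
              omega
      linarith
    have h3 : ∑ k ∈ Icc h K, ρ ^ k * ((c / (2 * D)) ^ n * A) ≤
        ∑ k ∈ range (K + 1), ρ ^ k * G (v - k) := by
      calc _ ≤ ∑ k ∈ Icc h K, ρ ^ k * G (v - k) := by
            refine sum_le_sum fun k hk => ?_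
            rw [mem_Icc] at hk
            have h4 := ih (v - k) (by omega) (by omega)
            rw [Nat.cast_sub (by omega)] at h4
            gcongr
        _ ≤ _ := by
          refine sum_le_sum_of_subset_of_nonneg ?_ fun k _ _ =>
            mul_nonneg (by positivity) (hG _)
          intro k
          simp only [mem_range, mem_Icc]
          omega
    rw [← sum_mul] at h3
    have h5 := hrec v hvI
    have h6 : 0 ≤ (c / (2 * D)) ^ n * A := by positivity
    have h7 : μ ≤ 2 * D * ∑ k ∈ Icc h K, ρ ^ k := by nlinarith
    refine le_of_mul_le_mul_left ?_ hμ0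
    calc μ * ((c / (2 * D)) ^ (n + 1) * A)
        ≤ 2 * D * (∑ k ∈ Icc h K, ρ ^ k) * ((c / (2 * D)) ^ (n + 1) * A) := by gcongr
      _ = c * ((∑ k ∈ Icc h K, ρ ^ k) * ((c / (2 * D)) ^ n * A)) := by
        rw [pow_succ]
        field_simp
      _ ≤ c * ∑ k ∈ range (K + 1), ρ ^ k * G (v - k) := by gcongr
      _ ≤ _ := h5

lemma transfer_core {B : ℕ} {c : ℝ} (hB : IsBlockBase B c) :
    ∃ C y₀ : ℝ, 0 < C ∧ (B : ℝ) ^ 2 ≤ y₀ ∧ ∀ y α μ X₀ Y A : ℝ, y₀ ≤ y → 1 / 20 ≤ α → α ≤ 1 →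
      log y ≤ μ → μ ≤ saddleSum y α → 0 < X₀ → X₀ ≤ Y → log Y ≤ μ → 0 ≤ A →
      (∀ v : ℕ, v ≤ numBlocks B y → X₀ * (B : ℝ) ^ v ≤ Y →
        A ≤ ((B : ℝ) ^ (-α)) ^ v * Psi (X₀ * (B : ℝ) ^ v) y) →
      C * A * (Y / X₀) ^ α ≤ Psi Y y := by
  obtain ⟨y₁, hy₁, hprop⟩ := exists_propagation
  have hk := kap_pos
  have hc := hB.c_pos
  have hB3 : (3 : ℝ) ≤ B := by exact_mod_cast hB.three_le
  have hB0 : (0 : ℝ) < B := by linarith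
  have hB1 : (1 : ℝ) < B := by linarith
  have hBn : 1 < B := by exact_mod_cast hB1
  have hl4 : 1 ≤ log 4 := by
    rw [show (4 : ℝ) = 2 ^ 2 by norm_num, log_pow]
    have := log_two_gt_d9
    push_cast
    linarith
  set D := kap⁻¹ * log 4 * B with hD
  have hD1 : 1 ≤ D := by
    have h1 : 1 ≤ kap⁻¹ := (one_le_inv₀ hk).2 kap_le_one
    calc (1 : ℝ) = 1 * 1 * 1 := by norm_num
      _ ≤ D := by rw [hD]; gcongr
  set r := c / 2 / (2 * D) with hr
  have hr0 : 0 < r := by positivity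
  refine ⟨r ^ 4 / (2 * B), max y₁ ((B : ℝ) ^ 2), by positivity, le_max_right _ _, ?_⟩
  intro y α μ X₀ Y A hy hα hα1 hyμ hμ hX₀ hXY hYμ hA hwin
  have hyy₁ : y₁ ≤ y := (le_max_left _ _).trans hy
  have hyB : (B : ℝ) ^ 2 ≤ y := (le_max_right _ _).trans hy
  have hy9 : 9 ≤ y := by nlinarith
  have hμ1 : 1 ≤ μ := by
    have : log (exp 1) ≤ log y := log_le_log (exp_pos 1) (by linarith [exp_one_lt_d9])
    rw [log_exp] at this
    linarith
  set K := numBlocks B y with hK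
  have hK2 : 2 ≤ K := by
    by_contra! hlt
    have h1 := lt_pow_numBlocks_succ hBn y
    have : (B : ℝ) ^ (K + 1) ≤ (B : ℝ) ^ 2 := pow_le_pow_right₀ hB1.le (by omega)
    linarith
  set b := (B : ℝ) ^ (-α) with hb
  have hb0 : 0 < b := rpow_pos_of_pos hB0 _
  set ρ := (B : ℝ) ^ (1 - α) with hρ
  have hρ1 : 1 ≤ ρ := one_le_rpow hB1.le (by linarith)
  have hρb : ρ = B * b := by
    rw [hρ, hb, sub_eq_add_neg, rpow_add hB0, rpow_one]
  obtain ⟨I, hI1, hI2⟩ := exists_nat_pow_near ((one_le_div hX₀).2 hXY) hB1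
  rw [le_div_iff₀ hX₀] at hI1
  rw [div_lt_iff₀ hX₀] at hI2
  set G : ℤ → ℝ := fun i => b ^ i * Psi (X₀ * (B : ℝ) ^ i) y with hG
  have hG0 : ∀ i, 0 ≤ G i := fun i => by positivity
  have hrec : ∀ i ≤ (I : ℤ), c / 2 * ∑ k ∈ range (K + 1), ρ ^ k * G (i - k) ≤ μ * G i := by
    intro i hi
    have h1 : ∑ k ∈ range (K + 1), ρ ^ k * G (i - k) = b ^ i * blockSum B y (X₀ * (B : ℝ) ^ i) := by
      rw [blockSum, mul_sum]
      refine sum_congr rfl fun k _ => ?_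
      simp only [hG]
      rw [hρb, mul_pow, zpow_sub₀ hb0.ne', zpow_sub₀ hB0.ne', zpow_natCast, zpow_natCast,
        ← mul_div_assoc]
      field_simp
    have h2 : X₀ * (B : ℝ) ^ i ≤ Y := by
      have : (B : ℝ) ^ i ≤ (B : ℝ) ^ I := by
        rw [← zpow_natCast]
        exact zpow_le_zpow_right₀ hB1.le hi
      nlinarith
    have h3 : 0 < X₀ * (B : ℝ) ^ i := by positivity
    have h4 := blockSum_le hB (y := y) (by linarith) hμ1
      ((log_le_log h3 h2).trans hYμ) h3
    rw [h1]
    simp only [hG]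
    have h5 : 0 < b ^ i := by positivity
    nlinarith
  have hμD : μ ≤ D * ∑ k ∈ range (K + 1), ρ ^ k :=
    hμ.trans (saddleSum_le_geom hBn (by linarith) hα)
  have hpowI : ∀ v : ℕ, v ≤ I → X₀ * (B : ℝ) ^ v ≤ Y := by
    intro v hv
    have : (B : ℝ) ^ v ≤ (B : ℝ) ^ I := pow_le_pow_right₀ hB1.le hv
    nlinarith
  have hext := block_extend hG0 (by positivity : 0 < c / 2) (by linarith [hB.c_le_one])
    (by linarith) hρ1 hD1 hA hrec hμD (fun v hv hvI => by
      have := hwin v hv (hpowI v (by exact_mod_cast hvI))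
      simpa [hG] using this) 4
  have hgrid : ∀ (Z : ℝ) (i : ℕ), X₀ ≤ Z → X₀ * (B : ℝ) ^ i ≤ Z → Z < X₀ * (B : ℝ) ^ (i + 1) →
      i ≤ 2 * K + 1 → i ≤ I → r ^ 4 * A / B * (Z / X₀) ^ α ≤ Psi Z y := by
    intro Z i hZ hi1 hi2 hiK hiI
    have h1 := hext i (by omega) (by exact_mod_cast hiI)
    simp only [hG, zpow_natCast] at h1
    have h2 : (Psi (X₀ * (B : ℝ) ^ i) y : ℝ) ≤ Psi Z y := Psi_mono_real y hi1
    have h3 : (Z / X₀) ^ α * b ^ i ≤ B := by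
      have h4 : (Z / X₀) ^ α ≤ ((B : ℝ) ^ (i + 1)) ^ α := by
        have : Z / X₀ ≤ (B : ℝ) ^ (i + 1) := by rw [div_le_iff₀ hX₀]; linarith
        have : 0 ≤ Z / X₀ := div_nonneg (by linarith) hX₀.le
        gcongr
      calc (Z / X₀) ^ α * b ^ i ≤ ((B : ℝ) ^ (i + 1)) ^ α * b ^ i := by gcongr
        _ = (B : ℝ) ^ α := by
          rw [hb, ← rpow_natCast, ← rpow_natCast, ← rpow_mul hB0.le, ← rpow_mul hB0.le,
            ← rpow_add hB0]
          congr 1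
          push_cast
          ring
        _ ≤ (B : ℝ) ^ (1 : ℝ) := rpow_le_rpow_of_exponent_le hB1.le hα1
        _ = B := rpow_one _
    have h5 : 0 ≤ (Z / X₀) ^ α := by
      have : 0 ≤ Z / X₀ := div_nonneg (by linarith) hX₀.le
      positivity
    have h6 : r ^ 4 * A ≤ b ^ i * Psi Z y := h1.trans (by gcongr)
    calc r ^ 4 * A / B * (Z / X₀) ^ α ≤ b ^ i * Psi Z y / B * (Z / X₀) ^ α :=
          mul_le_mul_of_nonneg_right (div_le_div_of_nonneg_right h6 hB0.le) h5
      _ = (Z / X₀) ^ α * b ^ i * (Psi Z y / B) := by ring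
      _ ≤ B * (Psi Z y / B) := by gcongr
      _ = Psi Z y := by field_simp
  rcases le_or_gt I (2 * K + 1) with hIK | hIK
  · have h1 := hgrid Y I hXY (by linarith) (by linarith) hIK le_rfl
    refine le_trans ?_ h1
    have : 0 ≤ Y / X₀ := div_nonneg (by linarith) hX₀.le
    have h2 : r ^ 4 / (2 * B) * A ≤ r ^ 4 * A / B := by
      rw [div_mul_eq_mul_div]
      have : 0 ≤ r ^ 4 * A := by positivity
      gcongr
      linarith
    gcongr
  · have h1 := hprop y α (r ^ 4 * A / B * X₀ ^ (-α)) X₀ hyy₁ hα hα1 (by positivity) hX₀ (by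
      intro Z hZ1 hZ2
      obtain ⟨i, hi1, hi2⟩ := exists_nat_pow_near ((one_le_div hX₀).2 hZ1) hB1
      rw [le_div_iff₀ hX₀] at hi1
      rw [div_lt_iff₀ hX₀] at hi2
      have hiK : i ≤ 2 * K + 1 := by
        by_contra! hlt
        have h2 : (B : ℝ) ^ (2 * K + 2) ≤ (B : ℝ) ^ i := pow_le_pow_right₀ hB1.le (by omega)
        have h3 : y ^ 2 < (B : ℝ) ^ (2 * K + 2) := by
          calc y ^ 2 < ((B : ℝ) ^ (K + 1)) ^ 2 := by
                have := lt_pow_numBlocks_succ hBn y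
                gcongr
            _ = _ := by rw [← pow_mul]; congr 1; ring
        have h4 : X₀ * y ^ 2 < X₀ * (B : ℝ) ^ i := by
          have := h3.trans_le h2
          gcongr
        linarith
      have h2 := hgrid Z i hZ1 (by linarith) (by linarith) hiK (by omega)
      refine le_trans (le_of_eq ?_) h2
      rw [div_rpow (by linarith) hX₀.le, rpow_neg hX₀.le]
      ring) Y hXY (hYμ.trans hμ)
    refine le_trans (le_of_eq ?_) h1
    rw [div_rpow (by linarith) hX₀.le, rpow_neg hX₀.le]
    field_simp

lemma sum_scales_eq_blockSum {B : ℕ} (hB : 0 < B) (y X₀ : ℝ) (i : ℤ) :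
    ∑ j ∈ Icc (i - numBlocks B y) i, ((B : ℝ) ^ j)⁻¹ * Psi (X₀ * (B : ℝ) ^ j) y =
      ((B : ℝ) ^ i)⁻¹ * blockSum B y (X₀ * (B : ℝ) ^ i) := by
  have hB0 : (B : ℝ) ≠ 0 := by positivity
  rw [blockSum, mul_sum]
  refine sum_nbij' (fun j => (i - j).toNat) (fun k => i - k) ?_ ?_ ?_ ?_ ?_
  · intro j hj
    rw [mem_Icc] at hj
    rw [mem_range]
    omega
  · intro k hk
    rw [mem_range] at hk
    rw [mem_Icc]
    omega
  · intro j hj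
    rw [mem_Icc] at hj
    omega
  · intro k _
    omega
  · intro j hj
    rw [mem_Icc] at hj
    have h1 : j = i - ((i - j).toNat : ℤ) := by omega
    set k := (i - j).toNat
    rw [h1, zpow_sub₀ hB0, zpow_natCast, ← mul_div_assoc]
    field_simp

/-- Comparison of a block sum of `Ψ` with `Ψ` at a larger scale, with the exponent `α`. -/
lemma exists_blockSum_transfer {B : ℕ} {c : ℝ} (hB : IsBlockBase B c) :
    ∃ C y₀ : ℝ, 0 < C ∧ (B : ℝ) ^ 2 ≤ y₀ ∧ ∀ y α μ X₀ Y : ℝ, y₀ ≤ y → 1 / 20 ≤ α → α ≤ 1 →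
      log y ≤ μ → μ ≤ saddleSum y α → 0 < X₀ → X₀ ≤ Y → log Y ≤ μ →
      blockSum B y X₀ * log y ≤ C * μ ^ 2 * (X₀ / Y) ^ α * Psi Y y := by
  obtain ⟨C, y₀, hC, hy₀, hcore⟩ := transfer_core hB
  have hk := kap_pos
  have hc := hB.c_pos
  have hc1 := hB.c_le_one
  have hB3 : (3 : ℝ) ≤ B := by exact_mod_cast hB.three_le
  have hB0 : (0 : ℝ) < B := by linarith
  have hB1 : (1 : ℝ) < B := by linarith
  have hBn : 1 < B := by exact_mod_cast hB1
  have hl4 : 1 ≤ log 4 := by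
    rw [show (4 : ℝ) = 2 ^ 2 by norm_num, log_pow]
    have := log_two_gt_d9
    push_cast
    linarith
  have hlB : 1 ≤ log B := by
    have : log (exp 1) ≤ log B := log_le_log (exp_pos 1) (by linarith [exp_one_lt_d9])
    rwa [log_exp] at this
  set D := kap⁻¹ * log 4 * B with hD
  have hD1 : 1 ≤ D := by
    have h1 : 1 ≤ kap⁻¹ := (one_le_inv₀ hk).2 kap_le_one
    calc (1 : ℝ) = 1 * 1 * 1 := by norm_num
      _ ≤ D := by rw [hD]; gcongr
  set c₁ := (c / 2) ^ 3 / (48 * D) with hc₁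
  have hc₁0 : 0 < c₁ := by positivity
  refine ⟨2 * log B / (C * c₁), y₀, by positivity, hy₀, ?_⟩
  intro y α μ X₀ Y hy hα hα1 hyμ hμ hX₀ hXY hYμ
  have hyB : (B : ℝ) ^ 2 ≤ y := hy₀.trans hy
  have hy9 : 9 ≤ y := by nlinarith
  have hly : 1 ≤ log y := by
    have : log (exp 1) ≤ log y := log_le_log (exp_pos 1) (by linarith [exp_one_lt_d9])
    rwa [log_exp] at this
  have hμ1 : 1 ≤ μ := by linarith
  have hY0 : 0 < Y := by linarith
  set K := numBlocks B y with hK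
  have hK1 : 1 ≤ K := by
    by_contra! hlt
    have h1 := lt_pow_numBlocks_succ hBn y
    have : (B : ℝ) ^ (K + 1) ≤ (B : ℝ) ^ 2 := pow_le_pow_right₀ hB1.le (by omega)
    linarith
  have hKR : (1 : ℝ) ≤ K := by exact_mod_cast hK1
  have hKlog : K * log B ≤ log y := by
    have := log_le_log (by positivity) (pow_numBlocks_le B (y := y) (by linarith))
    rwa [log_pow] at this
  have hKμ : (K : ℝ) ≤ μ := by nlinarith
  have hlogK : log y ≤ 2 * K * log B := by
    have := log_le_log (by linarith) (lt_pow_numBlocks_succ hBn y).le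
    rw [log_pow] at this
    push_cast at this
    nlinarith
  set b := (B : ℝ) ^ (-α) with hb
  have hb0 : 0 < b := rpow_pos_of_pos hB0 _
  set ρ := (B : ℝ) ^ (1 - α) with hρ
  have hρ1 : 1 ≤ ρ := one_le_rpow hB1.le (by linarith)
  have hρb : ρ = B * b := by
    rw [hρ, hb, sub_eq_add_neg, rpow_add hB0, rpow_one]
  have hμD : μ ≤ D * ∑ k ∈ range (K + 1), ρ ^ k :=
    hμ.trans (saddleSum_le_geom hBn (by linarith) hα)
  have hratio : (X₀ / Y) ^ α * (Y / X₀) ^ α = 1 := by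
    rw [← mul_rpow (by positivity) (by positivity)]
    have : X₀ / Y * (Y / X₀) = 1 := by field_simp
    rw [this, one_rpow]
  have hr0 : 0 < (X₀ / Y) ^ α := by positivity
  have hA : ∀ v : ℕ, v ≤ K → X₀ * (B : ℝ) ^ v ≤ Y →
      c₁ * (K / μ ^ 2) * blockSum B y X₀ ≤ b ^ v * Psi (X₀ * (B : ℝ) ^ v) y := by
    intro v hv hvY
    have h := block_lower_bound (H := fun j => ((B : ℝ) ^ j)⁻¹ * Psi (X₀ * (B : ℝ) ^ j) y)
      (fun i => by positivity) (K := K) (I := v) (c := c / 2) (μ := μ) (D := D) (ρ := ρ)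
      (by positivity) (by linarith) hK1 hKμ hρ1 hD1 (by
        intro i hi
        rw [sum_scales_eq_blockSum (by omega)]
        have h2 : X₀ * (B : ℝ) ^ i ≤ Y := by
          have : (B : ℝ) ^ i ≤ (B : ℝ) ^ v := by
            rw [← zpow_natCast]
            exact zpow_le_zpow_right₀ hB1.le hi
          nlinarith
        have h3 : 0 < X₀ * (B : ℝ) ^ i := by positivity
        have h4 := blockSum_le hB (y := y) (by linarith) hμ1
          ((log_le_log h3 h2).trans hYμ) h3
        have h5 : 0 < ((B : ℝ) ^ i)⁻¹ := by positivity
        nlinarith) hμD hv le_rfl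
    have h6 := sum_scales_eq_blockSum (by omega) y X₀ 0 (B := B)
    rw [zero_sub, zpow_zero] at h6
    simp only [inv_one, one_mul, mul_one] at h6
    rw [h6] at h
    refine h.trans (le_of_eq ?_)
    rw [zpow_natCast, hρb, mul_pow]
    field_simp
  have hbs : 0 ≤ blockSum B y X₀ := sum_nonneg fun k _ => by positivity
  have h := hcore y α μ X₀ Y _ hy hα hα1 hyμ hμ hX₀ hXY hYμ (by positivity) hA
  have h2 : C * (c₁ * (K / μ ^ 2) * blockSum B y X₀) ≤ (X₀ / Y) ^ α * Psi Y y := by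
    calc C * (c₁ * (K / μ ^ 2) * blockSum B y X₀)
        = (X₀ / Y) ^ α * (C * (c₁ * (K / μ ^ 2) * blockSum B y X₀) * (Y / X₀) ^ α) := by
          linear_combination (-(C * (c₁ * (K / μ ^ 2) * blockSum B y X₀))) * hratio
      _ ≤ _ := by gcongr
  calc blockSum B y X₀ * log y ≤ blockSum B y X₀ * (2 * K * log B) := by gcongr
    _ = 2 * log B / (C * c₁) * μ ^ 2 * (C * (c₁ * (K / μ ^ 2) * blockSum B y X₀)) := by
      field_simp
    _ ≤ 2 * log B / (C * c₁) * μ ^ 2 * ((X₀ / Y) ^ α * Psi Y y) := by gcongr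
    _ = 2 * log B / (C * c₁) * μ ^ 2 * (X₀ / Y) ^ α * Psi Y y := by ring

/-- Comparison of `Ψ` at two scales, with the exponent `α`. -/
lemma exists_Psi_transfer {B : ℕ} {c : ℝ} (hB : IsBlockBase B c) :
    ∃ C y₀ : ℝ, 0 < C ∧ (B : ℝ) ^ 2 ≤ y₀ ∧ ∀ y α μ X₀ Y : ℝ, y₀ ≤ y → 1 / 20 ≤ α → α ≤ 1 →
      log y ≤ μ → μ ≤ saddleSum y α → 0 < X₀ → X₀ ≤ Y → log Y ≤ μ →
      (Psi X₀ y : ℝ) ≤ C * μ * (X₀ / Y) ^ α * Psi Y y := by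
  obtain ⟨C, y₀, hC, hy₀, hcore⟩ := transfer_core hB
  have hc := hB.c_pos
  have hB3 : (3 : ℝ) ≤ B := by exact_mod_cast hB.three_le
  have hB0 : (0 : ℝ) < B := by linarith
  have hB1 : (1 : ℝ) < B := by linarith
  refine ⟨2 / (C * c), y₀, by positivity, hy₀, ?_⟩
  intro y α μ X₀ Y hy hα hα1 hyμ hμ hX₀ hXY hYμ
  have hyB : (B : ℝ) ^ 2 ≤ y := hy₀.trans hy
  have hy9 : 9 ≤ y := by nlinarith
  have hly : 1 ≤ log y := by
    have : log (exp 1) ≤ log y := log_le_log (exp_pos 1) (by linarith [exp_one_lt_d9])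
    rwa [log_exp] at this
  have hμ1 : 1 ≤ μ := by linarith
  have hY0 : 0 < Y := by linarith
  set K := numBlocks B y with hK
  set b := (B : ℝ) ^ (-α) with hb
  have hb0 : 0 < b := rpow_pos_of_pos hB0 _
  set ρ := (B : ℝ) ^ (1 - α) with hρ
  have hρ1 : 1 ≤ ρ := one_le_rpow hB1.le (by linarith)
  have hρb : ρ = B * b := by
    rw [hρ, hb, sub_eq_add_neg, rpow_add hB0, rpow_one]
  have hratio : (X₀ / Y) ^ α * (Y / X₀) ^ α = 1 := by
    rw [← mul_rpow (by positivity) (by positivity)]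
    have : X₀ / Y * (Y / X₀) = 1 := by field_simp
    rw [this, one_rpow]
  have hr0 : 0 < (X₀ / Y) ^ α := by positivity
  have hA : ∀ v : ℕ, v ≤ K → X₀ * (B : ℝ) ^ v ≤ Y →
      c / (2 * μ) * Psi X₀ y ≤ b ^ v * Psi (X₀ * (B : ℝ) ^ v) y := by
    intro v hv hvY
    have h3 : 0 < X₀ * (B : ℝ) ^ v := by positivity
    have h4 := blockSum_le hB (y := y) (by linarith) hμ1
          ((log_le_log h3 hvY).trans hYμ) h3
    have h5 : (B : ℝ) ^ v * Psi X₀ y ≤ blockSum B y (X₀ * (B : ℝ) ^ v) := by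
      have := single_le_sum (f := fun k => (B : ℝ) ^ k *
        (Psi (X₀ * (B : ℝ) ^ v / (B : ℝ) ^ k) y : ℝ)) (fun k _ => by positivity)
        (mem_range.2 (by omega : v < K + 1))
      rw [mul_div_cancel_right₀ _ (by positivity)] at this
      exact this
    have h6 : 1 ≤ b ^ v * (B : ℝ) ^ v := by
      rw [← mul_pow, mul_comm b, ← hρb]
      exact one_le_pow₀ hρ1
    have h7 : (Psi X₀ y : ℝ) ≤ b ^ v * (B : ℝ) ^ v * Psi X₀ y :=
      le_mul_of_one_le_left (by positivity) h6
    rw [div_mul_eq_mul_div, div_le_iff₀ (by positivity)]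
    calc c * Psi X₀ y ≤ c * (b ^ v * (B : ℝ) ^ v * Psi X₀ y) := by gcongr
      _ = 2 * b ^ v * (c / 2 * ((B : ℝ) ^ v * Psi X₀ y)) := by ring
      _ ≤ 2 * b ^ v * (c / 2 * blockSum B y (X₀ * (B : ℝ) ^ v)) := by gcongr
      _ ≤ 2 * b ^ v * (μ * Psi (X₀ * (B : ℝ) ^ v) y) := by gcongr
      _ = _ := by ring
  have h := hcore y α μ X₀ Y _ hy hα hα1 hyμ hμ hX₀ hXY hYμ (by positivity) hA
  have h2 : C * (c / (2 * μ) * Psi X₀ y) ≤ (X₀ / Y) ^ α * Psi Y y := by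
    calc C * (c / (2 * μ) * Psi X₀ y)
        = (X₀ / Y) ^ α * (C * (c / (2 * μ) * Psi X₀ y) * (Y / X₀) ^ α) := by
          linear_combination (-(C * (c / (2 * μ) * Psi X₀ y))) * hratio
      _ ≤ _ := by gcongr
  calc (Psi X₀ y : ℝ) = 2 / (C * c) * μ * (C * (c / (2 * μ) * Psi X₀ y)) := by field_simp
    _ ≤ 2 / (C * c) * μ * ((X₀ / Y) ^ α * Psi Y y) := by gcongr
    _ = 2 / (C * c) * μ * (X₀ / Y) ^ α * Psi Y y := by ring

/-- A smooth number `n ≥ q` has divisors of size between `q` and `q * y`, and such a divisor can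
be chosen as a multiple of a prescribed divisor of size at most `q * y`. -/
lemma exists_dvd_between {y : ℝ} {n q D : ℕ} (hn : IsSmooth y n) (hn0 : n ≠ 0) (hy : 0 < y)
    (hqn : q ≤ n) (hDn : D ∣ n) (hD : (D : ℝ) ≤ q * y) :
    ∃ κ, D ∣ κ ∧ κ ∣ n ∧ q ≤ κ ∧ (κ : ℝ) ≤ q * y := by
  have hex : ∃ κ, D ∣ κ ∧ κ ∣ n ∧ q ≤ κ := ⟨n, hDn, dvd_rfl, hqn⟩
  obtain ⟨h1, h2, h3⟩ := Nat.find_spec hex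
  refine ⟨Nat.find hex, h1, h2, h3, ?_⟩
  have hmin := fun m => Nat.find_min hex (m := m)
  set κ := Nat.find hex
  by_contra! hlt
  have hκ0 : κ ≠ 0 := fun h => hn0 (by rw [h] at h2; exact zero_dvd_iff.1 h2)
  obtain ⟨e, he⟩ := h1
  have he1 : e ≠ 1 := by
    rintro rfl
    rw [mul_one] at he
    rw [he] at hlt
    linarith
  obtain ⟨p, hp, hpe⟩ := Nat.exists_prime_and_dvd he1
  obtain ⟨g, rfl⟩ := hpe
  have hκ : κ = p * (D * g) := by rw [he]; ring
  have hpy : (p : ℝ) ≤ y := hn p hp ((Dvd.intro _ hκ.symm).trans h2)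
  have hg0 : 0 < D * g := Nat.pos_of_ne_zero fun h => hκ0 (by rw [hκ, h, mul_zero])
  have hlt2 : D * g < κ := by
    rw [hκ]
    exact lt_mul_of_one_lt_left hg0 hp.one_lt
  refine hmin _ hlt2 ⟨Dvd.intro _ rfl, (Dvd.intro_left _ hκ.symm).trans h2, ?_⟩
  by_contra! hlt3
  have h4 : ((D * g : ℕ) : ℝ) ≤ q := by exact_mod_cast hlt3.le
  have h5 : (κ : ℝ) = p * ((D * g : ℕ) : ℝ) := by exact_mod_cast hκ
  have h6 : (p : ℝ) * ((D * g : ℕ) : ℝ) ≤ y * q := by gcongr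
  linarith

/-- The divisors of `n` between `q` and `q * y`. -/
def divisorsBetween (q : ℕ) (y : ℝ) (n : ℕ) : Finset ℕ :=
  n.divisors.filter fun κ => q ≤ κ ∧ (κ : ℝ) ≤ q * y

/-- Counting pairs `(n, κ)` with `n` smooth in a reduced residue class modulo `q` and `κ` a divisor
of `n` between `q` and `q * y`. -/
lemma sum_card_divisorsBetween_le {B q a : ℕ} {y Z : ℝ} (hB : 1 < B) (hq : 0 < q)
    (hqa : a.Coprime q) {S : Finset ℕ}
    (hS : ∀ n ∈ S, n ∈ smoothUpTo Z y ∧ n ≡ a [MOD q]) :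
    ∑ n ∈ S, ((divisorsBetween q y n).card : ℝ) ≤ B * blockSum B y (Z / q) := by
  have hqR : (0 : ℝ) < q := by exact_mod_cast hq
  have hcard : (S.sigma (divisorsBetween q y)).card ≤ ((range (numBlocks B y + 1)).sigma
      fun k => smoothUpTo (Z / q / (B : ℝ) ^ k) y ×ˢ range (B ^ (k + 1))).card := by
    refine card_le_card_of_injOn (fun t => ⟨Nat.log B (t.2 / q), (t.1 / t.2, t.2 / q)⟩) ?_ ?_
    · rintro ⟨n, κ⟩ h
      simp only [coe_sigma, Set.mem_sigma_iff, mem_coe, divisorsBetween, mem_filter,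
        Nat.mem_divisors] at h
      obtain ⟨hnS, ⟨hκn, hn0⟩, hqκ, hκy⟩ := h
      obtain ⟨hn1, hnZ, hns⟩ := mem_smoothUpTo.1 (hS n hnS).1
      have hκ0 : 0 < κ := lt_of_lt_of_le hq hqκ
      have hκR : (0 : ℝ) < κ := by exact_mod_cast hκ0
      have hκq : κ / q ≠ 0 := (Nat.div_pos hqκ hq).ne'
      have hpow : B ^ Nat.log B (κ / q) ≤ κ / q := Nat.pow_log_le_self B hκq
      simp only [coe_sigma, Set.mem_sigma_iff, mem_coe, mem_product, mem_range]
      refine ⟨?_, ?_, Nat.lt_pow_succ_log_self hB _⟩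
      · refine Nat.lt_succ_of_le (Nat.log_mono_right (Nat.le_floor ?_))
        refine Nat.cast_div_le.trans ?_
        rw [div_le_iff₀ hqR]
        linarith
      · refine mem_smoothUpTo.2 ⟨Nat.div_pos (Nat.le_of_dvd hn1 hκn) hκ0, ?_,
          isSmooth_of_dvd hns (Nat.div_dvd_of_dvd hκn)⟩
        rw [div_div, le_div_iff₀ (by positivity)]
        have h1 : (q : ℝ) * (B : ℝ) ^ Nat.log B (κ / q) ≤ κ := by
          have : q * B ^ Nat.log B (κ / q) ≤ κ :=
            (Nat.mul_le_mul_left q hpow).trans (Nat.mul_div_le κ q)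
          exact_mod_cast this
        calc ((n / κ : ℕ) : ℝ) * (q * (B : ℝ) ^ Nat.log B (κ / q)) ≤ ((n / κ : ℕ) : ℝ) * κ := by
              gcongr
          _ = n := by exact_mod_cast Nat.div_mul_cancel hκn
          _ ≤ Z := hnZ
    · rintro ⟨n, κ⟩ h ⟨n', κ'⟩ h' heq
      simp only [coe_sigma, Set.mem_sigma_iff, mem_coe, divisorsBetween, mem_filter,
        Nat.mem_divisors] at h h'
      obtain ⟨hnS, ⟨hκn, hn0⟩, hqκ, hκy⟩ := h
      obtain ⟨hnS', ⟨hκn', hn0'⟩, hqκ', hκy'⟩ := h'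
      simp only [Sigma.mk.injEq, heq_eq_eq, Prod.mk.injEq] at heq
      obtain ⟨-, hm, hκq⟩ := heq
      set m := n / κ with hm'
      have hn : m * κ = n := Nat.div_mul_cancel hκn
      have hn' : m * κ' = n' := by rw [hm]; exact Nat.div_mul_cancel hκn'
      have hc1 : m * κ ≡ a [MOD q] := hn ▸ (hS n hnS).2
      have hc2 : m * κ' ≡ a [MOD q] := hn' ▸ (hS n' hnS').2
      have hcop : q.Coprime m := by
        have h1 : (m * κ).Coprime q := by
          rw [Nat.Coprime, hc1.gcd_eq]
          exact hqa
        exact (Nat.Coprime.coprime_mul_right h1).symm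
      have h2 : κ ≡ κ' [MOD q] :=
        Nat.ModEq.cancel_left_of_coprime hcop (hc1.trans hc2.symm)
      have h3 : κ = κ' := by
        rw [← Nat.div_add_mod κ q, ← Nat.div_add_mod κ' q, hκq, h2]
      subst h3
      rw [← hn, ← hn']
  rw [card_sigma, card_sigma] at hcard
  have h1 : (∑ n ∈ S, ((divisorsBetween q y n).card : ℝ)) ≤
      ∑ k ∈ range (numBlocks B y + 1),
        ((smoothUpTo (Z / q / (B : ℝ) ^ k) y ×ˢ range (B ^ (k + 1))).card : ℝ) := by
    exact_mod_cast hcard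
  refine h1.trans (le_of_eq ?_)
  rw [blockSum, mul_sum]
  refine sum_congr rfl fun k _ => ?_
  rw [card_product, card_range, Psi_eq_card]
  push_cast
  ring

lemma card_lt_modulus_le_one {q a : ℕ} {S : Finset ℕ}
    (hS : ∀ n ∈ S, n ≡ a [MOD q] ∧ n < q) : S.card ≤ 1 := by
  refine card_le_one.2 fun n hn m hm => ?_
  exact Nat.ModEq.eq_of_lt_of_lt ((hS n hn).1.trans (hS m hm).1.symm) (hS n hn).2 (hS m hm).2

lemma card_coprime_residue_le {B q a : ℕ} {y Z : ℝ} (hB : 1 < B) (hq : 0 < q)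
    (hy : 1 ≤ y) (hqa : a.Coprime q) :
    ((((smoothUpTo Z y).filter (· ≡ a [MOD q])).card : ℕ) : ℝ) ≤
      1 + B * blockSum B y (Z / q) := by
  set S := (smoothUpTo Z y).filter (· ≡ a [MOD q])
  have h1 : ((S.filter (· < q)).card : ℝ) ≤ 1 := by
    exact_mod_cast card_lt_modulus_le_one (a := a) fun n hn => by
      simp only [S, mem_filter] at hn
      exact ⟨hn.1.2, hn.2⟩
  have h2 : ((S.filter (¬ · < q)).card : ℝ) ≤ B * blockSum B y (Z / q) := by
    refine le_trans ?_ (sum_card_divisorsBetween_le hB hq hqa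
      (S := S.filter (¬ · < q)) fun n hn => by
        simp only [S, mem_filter] at hn
        exact hn.1)
    rw [card_eq_sum_ones]
    push_cast
    refine sum_le_sum fun n hn => ?_
    simp only [S, mem_filter, not_lt] at hn
    obtain ⟨hn1, -, hns⟩ := mem_smoothUpTo.1 hn.1.1
    have hqy : ((1 : ℕ) : ℝ) ≤ q * y := by
      have : (1 : ℝ) ≤ q := by exact_mod_cast hq
      push_cast
      nlinarith
    obtain ⟨κ, -, h3, h4, h5⟩ := exists_dvd_between hns (by omega) (by linarith) hn.2
      (one_dvd n) hqy
    have : 0 < (divisorsBetween q y n).card :=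
      card_pos.2 ⟨κ, mem_filter.2 ⟨Nat.mem_divisors.2 ⟨h3, by omega⟩, h4, h5⟩⟩
    exact_mod_cast this
  have h3 := card_filter_add_card_filter_not (s := S) (· < q)
  have h4 : (S.card : ℝ) = (S.filter (· < q)).card + (S.filter (¬ · < q)).card := by
    exact_mod_cast h3.symm
  linarith

/-- The part of `log n` coming from the prime powers up to `z`. -/
def truncLog (y z : ℝ) (n : ℕ) : ℝ :=
  ∑ t ∈ (primesUpTo y).sigma (fun p => Icc 1 (Nat.log p ⌊z⌋₊)),
    if t.1 ^ t.2 ∣ n then log t.1 else 0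

lemma truncLog_le_log {y : ℝ} (hy : 0 ≤ y) (z : ℝ) {n : ℕ} (hn : n ≠ 0) :
    truncLog y z n ≤ log n :=
  sum_log_dvd_le_log _ (fun _ hp => ((mem_primesUpTo hy).1 hp).1) _ hn

lemma truncLog_nonneg (y z : ℝ) (n : ℕ) : 0 ≤ truncLog y z n :=
  sum_nonneg fun t _ => by
    have : 0 ≤ log (t.1 : ℝ) := log_natCast_nonneg _
    split_ifs <;> simp [this]

lemma le_truncLog {y z W c : ℝ} {n : ℕ} (hy : 1 ≤ y) (hyz : y ≤ z) (hn : IsSmooth y n)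
    (hc0 : 0 ≤ c) (hc : c ≤ 1) (hcW : c * log W ≤ log z / 2)
    (hW : ∀ p ∈ primesUpTo y, ((p ^ n.factorization p : ℕ) : ℝ) ≤ W) :
    c * log n ≤ truncLog y z n := by
  have h1 : log n = ∑ p ∈ primesUpTo y, n.factorization p * log p := by
    rw [log_nat_eq_sum_factorization, Finsupp.sum]
    refine sum_subset ?_ ?_
    · intro p hp
      rw [Nat.support_factorization, Nat.mem_primeFactors] at hp
      exact (mem_primesUpTo (by linarith)).2 ⟨hp.1, hn p hp.1 hp.2.1⟩
    · intro p _ hp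
      rw [Finsupp.notMem_support_iff] at hp
      simp [hp]
  rw [h1, mul_sum, truncLog, sum_sigma]
  refine sum_le_sum fun p hp => ?_
  obtain ⟨hpp, hpy⟩ := (mem_primesUpTo (by linarith)).1 hp
  have hl : 0 ≤ log (p : ℝ) := log_natCast_nonneg _
  have hp0 : (0 : ℝ) < p := by exact_mod_cast hpp.pos
  set v := n.factorization p with hv
  set J := Nat.log p ⌊z⌋₊ with hJ
  have hpz : p ≤ ⌊z⌋₊ := Nat.le_floor (hpy.trans hyz)
  have hJ1 : 1 ≤ J := by
    rw [hJ]
    exact Nat.log_pos hpp.one_lt hpz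
  have h2 : (min v J : ℕ) * log p ≤
      ∑ k ∈ Icc 1 J, if p ^ k ∣ n then log (p : ℝ) else 0 := by
    calc (min v J : ℕ) * log (p : ℝ) = ∑ k ∈ Icc 1 (min v J), log (p : ℝ) := by
          rw [sum_const, Nat.card_Icc, nsmul_eq_mul, Nat.add_sub_cancel]
      _ = ∑ k ∈ Icc 1 (min v J), if p ^ k ∣ n then log (p : ℝ) else 0 := by
          refine sum_congr rfl fun k hk => ?_
          rw [mem_Icc] at hk
          rw [if_pos]
          exact (pow_dvd_pow p (hk.2.trans (min_le_left _ _))).trans (Nat.ordProj_dvd n p)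
      _ ≤ _ := by
          refine sum_le_sum_of_subset_of_nonneg
            (Icc_subset_Icc le_rfl (min_le_right _ _)) fun k _ _ => ?_
          split_ifs <;> simp [hl]
  refine le_trans ?_ h2
  rcases le_total v J with h | h
  · rw [min_eq_left h]
    have : 0 ≤ (v : ℝ) * log p := by positivity
    nlinarith
  · rw [min_eq_right h]
    have hz : 1 ≤ z := hy.trans hyz
    have h3 : log z ≤ (J + 1 : ℕ) * log p := by
      rw [← log_pow]
      refine log_le_log (by linarith) ?_
      have : ⌊z⌋₊ < p ^ (J + 1) := Nat.lt_pow_succ_log_self hpp.one_lt _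
      exact_mod_cast ((Nat.floor_lt (by linarith)).1 this).le
    have h4 : v * log (p : ℝ) ≤ log W := by
      rw [← log_pow]
      refine log_le_log (by positivity) ?_
      exact_mod_cast hW p hp
    have h5 : ((J + 1 : ℕ) : ℝ) ≤ 2 * J := by
      exact_mod_cast (by omega : J + 1 ≤ 2 * J)
    have h6 : ((J + 1 : ℕ) : ℝ) * log p ≤ 2 * J * log p := by gcongr
    have h7 : c * (v * log (p : ℝ)) ≤ c * log W := by gcongr
    linarith

/-- The `r`-th moment of `truncLog` over a residue class is controlled by block sums. -/
lemma card_mul_pow_le {B q a r : ℕ} {y Z z M : ℝ} (hB : 1 < B) (hq : 0 < q) (hy : 1 ≤ y)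
    (hqa : a.Coprime q) (hz : 0 ≤ z) (hzr : z ^ r ≤ q * y) (hM : 0 ≤ M) {S : Finset ℕ}
    (hS : ∀ n ∈ S, n ∈ smoothUpTo Z y ∧ n ≡ a [MOD q])
    (hSq : ∀ n ∈ S, q ≤ n) (hSM : ∀ n ∈ S, M ≤ truncLog y z n) :
    S.card * M ^ r ≤ log (q * y) ^ r * (B * blockSum B y (Z / q)) := by
  have hqR : (1 : ℝ) ≤ q := by exact_mod_cast hq
  have hlq : 0 ≤ log (q * y) := log_nonneg (by nlinarith)
  have key : ∀ n ∈ S, truncLog y z n ^ r ≤ ∑ κ ∈ divisorsBetween q y n, truncLog y z κ ^ r := by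
    intro n hn
    obtain ⟨hn1, -, hns⟩ := mem_smoothUpTo.1 (hS n hn).1
    simp only [truncLog, sum_pow']
    rw [sum_comm]
    refine sum_le_sum fun τ hτ => ?_
    rw [Fintype.mem_piFinset] at hτ
    have hnn : ∀ κ : ℕ, 0 ≤ ∏ i, if (τ i).1 ^ (τ i).2 ∣ κ then log ((τ i).1 : ℝ) else 0 :=
      fun κ => prod_nonneg fun i _ => by
        have : 0 ≤ log ((τ i).1 : ℝ) := log_natCast_nonneg _
        split_ifs <;> simp [this]
    by_cases hall : ∀ i, (τ i).1 ^ (τ i).2 ∣ n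
    · set D := univ.lcm fun i => (τ i).1 ^ (τ i).2 with hD
      have hDn : D ∣ n := Finset.lcm_dvd fun i _ => hall i
      have hDle : (D : ℝ) ≤ q * y := by
        refine le_trans ?_ hzr
        have h1 : D ∣ ∏ i, (τ i).1 ^ (τ i).2 :=
          Finset.lcm_dvd fun i hi => dvd_prod_of_mem _ hi
        have h2 : D ≤ ∏ i, (τ i).1 ^ (τ i).2 := by
          refine Nat.le_of_dvd (prod_pos fun i _ => ?_) h1
          have h3 := hτ i
          rw [mem_sigma, mem_primesUpTo (by linarith)] at h3
          exact pow_pos h3.1.1.pos _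
        calc (D : ℝ) ≤ ((∏ i, (τ i).1 ^ (τ i).2 : ℕ) : ℝ) := by exact_mod_cast h2
          _ = ∏ i, (((τ i).1 ^ (τ i).2 : ℕ) : ℝ) := by push_cast; rfl
          _ ≤ ∏ _i : Fin r, z := by
            refine prod_le_prod (fun i _ => by positivity) fun i _ => ?_
            have h3 := hτ i
            rw [mem_sigma, mem_Icc] at h3
            have h4 : ⌊z⌋₊ ≠ 0 := by
              intro h5
              rw [h5, Nat.log_zero_right] at h3
              omega
            exact (Nat.cast_le.2 (Nat.pow_le_of_le_log h4 h3.2.2)).trans (Nat.floor_le hz)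
          _ = z ^ r := by simp
      obtain ⟨κ, h1, h2, h3, h4⟩ := exists_dvd_between hns (by omega) (by linarith)
        (hSq n hn) hDn hDle
      have h5 : κ ∈ divisorsBetween q y n :=
        mem_filter.2 ⟨Nat.mem_divisors.2 ⟨h2, by omega⟩, h3, h4⟩
      refine le_trans (le_of_eq ?_) (single_le_sum (fun κ _ => hnn κ) h5)
      refine prod_congr rfl fun i _ => ?_
      rw [if_pos (hall i), if_pos ((Finset.dvd_lcm (mem_univ i)).trans h1)]
    · push Not at hall
      obtain ⟨i, hi⟩ := hall
      rw [prod_eq_zero (mem_univ i) (if_neg hi)]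
      exact sum_nonneg fun κ _ => hnn κ
  calc (S.card : ℝ) * M ^ r = ∑ n ∈ S, M ^ r := by rw [sum_const, nsmul_eq_mul]
    _ ≤ ∑ n ∈ S, truncLog y z n ^ r := by
      refine sum_le_sum fun n hn => ?_
      have := hSM n hn
      gcongr
    _ ≤ ∑ n ∈ S, ∑ κ ∈ divisorsBetween q y n, truncLog y z κ ^ r := sum_le_sum key
    _ ≤ ∑ n ∈ S, log (q * y) ^ r * ((divisorsBetween q y n).card : ℝ) := by
      refine sum_le_sum fun n hn => ?_
      rw [mul_comm, ← nsmul_eq_mul]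
      refine sum_le_card_nsmul _ _ _ fun κ hκ => ?_
      simp only [divisorsBetween, mem_filter] at hκ
      have hκ0 : 0 < κ := lt_of_lt_of_le hq hκ.2.1
      have h1 := truncLog_le_log (y := y) (by linarith) z hκ0.ne'
      have h2 : log (κ : ℝ) ≤ log (q * y) :=
        log_le_log (by exact_mod_cast hκ0) hκ.2.2
      have := truncLog_nonneg y z κ
      gcongr
      linarith
    _ = log (q * y) ^ r * ∑ n ∈ S, ((divisorsBetween q y n).card : ℝ) := by rw [mul_sum]
    _ ≤ _ := by
      gcongr
      exact sum_card_divisorsBetween_le hB hq hqa hS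

/-- Few smooth numbers are divisible by a large power of a prime. -/
lemma card_large_prime_power_le {y Z W : ℝ} (hy : 1 ≤ y) (hZ : 0 ≤ Z) (hW : 1 ≤ W)
    {S : Finset ℕ} (hS : S ⊆ smoothUpTo Z y)
    (hbad : ∀ n ∈ S, ∃ p ∈ primesUpTo y, W < ((p ^ n.factorization p : ℕ) : ℝ)) :
    (S.card : ℝ) ≤ 2 * y * Psi (Z / W) y := by
  have h1 : S ⊆ (primesUpTo y).biUnion fun p =>
      (smoothUpTo Z y).filter (p ^ (Nat.log p ⌊W⌋₊ + 1) ∣ ·) := by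
    intro n hn
    obtain ⟨p, hp, hpW⟩ := hbad n hn
    have hpp := ((mem_primesUpTo (by linarith)).1 hp).1
    refine mem_biUnion.2 ⟨p, hp, mem_filter.2 ⟨hS hn, ?_⟩⟩
    refine (pow_dvd_pow p ?_).trans (Nat.ordProj_dvd n p)
    rw [Nat.succ_le_iff, ← Nat.pow_lt_pow_iff_right hpp.one_lt]
    have h2 : p ^ Nat.log p ⌊W⌋₊ ≤ ⌊W⌋₊ :=
      Nat.pow_log_le_self p (Nat.floor_pos.2 hW).ne'
    exact h2.trans_lt ((Nat.floor_lt (by linarith)).2 hpW)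
  have h2 : ∀ p ∈ primesUpTo y,
      ((smoothUpTo Z y).filter (p ^ (Nat.log p ⌊W⌋₊ + 1) ∣ ·)).card ≤ Psi (Z / W) y := by
    intro p hp
    have hpp := ((mem_primesUpTo (by linarith)).1 hp).1
    refine (card_dvd_le_Psi_div Z y (pow_pos hpp.pos _)).trans (Psi_mono y ?_)
    have h3 : W < ((p ^ (Nat.log p ⌊W⌋₊ + 1) : ℕ) : ℝ) :=
      (Nat.floor_lt (by linarith)).1 (Nat.lt_pow_succ_log_self hpp.one_lt _)
    gcongr
  have h3 : S.card ≤ (primesUpTo y).card * Psi (Z / W) y :=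
    (card_le_card h1).trans (card_biUnion_le_card_mul _ _ _ h2)
  have h4 : ((primesUpTo y).card : ℝ) ≤ 2 * y := by
    have h5 : (primesUpTo y).card ≤ ⌊y⌋₊ + 1 :=
      (card_filter_le _ _).trans_eq (card_range _)
    have h6 : ((primesUpTo y).card : ℝ) ≤ ⌊y⌋₊ + 1 := by exact_mod_cast h5
    linarith [Nat.floor_le (by linarith : 0 ≤ y)]
  calc (S.card : ℝ) ≤ (primesUpTo y).card * (Psi (Z / W) y : ℝ) := by exact_mod_cast h3
    _ ≤ _ := by gcongr

lemma saddleSum_add_ge {y α η : ℝ} (hy : 1 ≤ y) (hα : 1 / 20 ≤ α) (hη : 0 ≤ η) :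
    saddleSum y α * (1 - η * log y / kap) ≤ saddleSum y (α + η) := by
  have hk := kap_pos
  rw [saddleSum, sum_mul, saddleSum]
  refine sum_le_sum fun p hp => ?_
  obtain ⟨hpp, hpy⟩ := (mem_primesUpTo (by linarith)).1 hp
  have h2 : (2 : ℝ) ≤ p := by exact_mod_cast hpp.two_le
  have hp0 : (0 : ℝ) < p := by linarith
  have hl : 0 ≤ log (p : ℝ) := log_natCast_nonneg _
  have hly : log (p : ℝ) ≤ log y := log_le_log hp0 hpy
  have hP0 : 0 < (p : ℝ) ^ α := by positivity
  have hE0 : 0 < (p : ℝ) ^ η := by positivity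
  have hP : 0 < (p : ℝ) ^ α - 1 := lt_of_lt_of_le (by positivity) (kap_mul_le hα h2)
  have hPE' := kap_mul_le (α := α + η) (by linarith) h2
  have hPE : 0 < (p : ℝ) ^ (α + η) - 1 := lt_of_lt_of_le (by positivity) hPE'
  rw [rpow_add hp0] at hPE hPE' ⊢
  set P := (p : ℝ) ^ α
  set E := (p : ℝ) ^ η with hE
  have hElog : log E = η * log p := log_rpow hp0 η
  have h3 : E - 1 ≤ E * (η * log y) := by
    have h4 := one_sub_inv_le_log_of_pos hE0
    have h5 : E * (1 - E⁻¹) = E - 1 := by field_simp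
    have h6 : η * log p ≤ η * log y := by gcongr
    rw [← h5]
    gcongr
    linarith
  have hly0 : 0 ≤ log y := hl.trans hly
  have h7 : P * (E - 1) ≤ (P * E - 1) * (η * log y / kap) := by
    calc P * (E - 1) ≤ P * (E * (η * log y)) := by gcongr
      _ = kap * (P * E) * (η * log y / kap) := by field_simp
      _ ≤ _ := by gcongr
  rw [div_mul_eq_mul_div, div_le_div_iff₀ hP hPE]
  have h8 : (1 - η * log y / kap) * (P * E - 1) ≤ P - 1 := by linarith
  calc log p * (1 - η * log y / kap) * (P * E - 1)
      = log p * ((1 - η * log y / kap) * (P * E - 1)) := by ring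
    _ ≤ log p * (P - 1) := by gcongr

/-- If `Y` is the geometric mean of `X₀` and `Y * Q`, the block sum at `X₀` is small compared with
the one at `Y`. -/
lemma exists_blockSum_compare {B : ℕ} {c : ℝ} (hB : IsBlockBase B c) :
    ∃ C y₀ : ℝ, 0 < C ∧ (B : ℝ) ^ 2 ≤ y₀ ∧ ∀ y α μ X₀ Y : ℝ, y₀ ≤ y → 1 / 20 ≤ α → α ≤ 1 →
      log y ≤ μ → μ ≤ saddleSum y α → 0 < X₀ → X₀ * y ≤ Y → log Y ≤ μ →
      blockSum B y X₀ * log y ≤ C * μ * (X₀ / Y) ^ α * blockSum B y Y := by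
  obtain ⟨C, y₀, hC, hy₀, htrans⟩ := exists_blockSum_transfer hB
  have hk := kap_pos
  have hB3 : (3 : ℝ) ≤ B := by exact_mod_cast hB.three_le
  have hB0 : (0 : ℝ) < B := by linarith
  have hB1 : (1 : ℝ) ≤ B := by linarith
  have hBn : 1 < B := by have := hB.three_le; omega
  have hl4 : 0 < log 4 := log_pos (by norm_num)
  set D := kap⁻¹ * log 4 * B with hD
  have hD0 : 0 < D := by positivity
  refine ⟨D * C, y₀, by positivity, hy₀, ?_⟩
  intro y α μ X₀ Y hy hα hα1 hyμ hμ hX₀ hXY hYμ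
  have hyB : (B : ℝ) ^ 2 ≤ y := hy₀.trans hy
  have hy9 : 9 ≤ y := by nlinarith
  have hy1 : 1 ≤ y := by linarith
  have hly : 0 < log y := log_pos (by linarith)
  have hμ0 : 0 < μ := by linarith
  have hY0 : 0 < Y := by nlinarith
  set ρ := (B : ℝ) ^ (1 - α) with hρ
  have hr0 : 0 ≤ (X₀ / Y) ^ α := by positivity
  have hΘ : 0 ≤ blockSum B y X₀ := sum_nonneg fun k _ => by positivity
  have hterm : ∀ k ∈ range (numBlocks B y + 1), ρ ^ k * (blockSum B y X₀ * log y) ≤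
      C * μ ^ 2 * (X₀ / Y) ^ α * ((B : ℝ) ^ k * Psi (Y / (B : ℝ) ^ k) y) := by
    intro k hkr
    rw [mem_range] at hkr
    have hBk : (B : ℝ) ^ k ≤ y :=
      (pow_le_pow_right₀ hB1 (by omega)).trans (pow_numBlocks_le B hy1)
    have hBk1 : 1 ≤ (B : ℝ) ^ k := one_le_pow₀ hB1
    have h1 : X₀ ≤ Y / (B : ℝ) ^ k := by
      rw [le_div_iff₀ (by positivity)]
      nlinarith
    have h2 : log (Y / (B : ℝ) ^ k) ≤ μ :=
      (log_le_log (by positivity) (div_le_self hY0.le hBk1)).trans hYμ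
    have h3 := htrans y α μ X₀ (Y / (B : ℝ) ^ k) hy hα hα1 hyμ hμ hX₀ h1 h2
    have h4 : ρ ^ k * (X₀ / (Y / (B : ℝ) ^ k)) ^ α = (X₀ / Y) ^ α * (B : ℝ) ^ k := by
      have h5 : X₀ / (Y / (B : ℝ) ^ k) = X₀ / Y * (B : ℝ) ^ k := by field_simp
      have h6 : ρ ^ k * ((B : ℝ) ^ k) ^ α = (B : ℝ) ^ k := by
        rw [hρ, ← rpow_natCast, ← rpow_natCast, ← rpow_mul hB0.le, ← rpow_mul hB0.le,
          ← rpow_add hB0]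
        congr 1
        ring
      rw [h5, mul_rpow (by positivity) (by positivity), mul_left_comm, h6]
    have hρk : 0 ≤ ρ ^ k := by positivity
    calc ρ ^ k * (blockSum B y X₀ * log y)
        ≤ ρ ^ k * (C * μ ^ 2 * (X₀ / (Y / (B : ℝ) ^ k)) ^ α * Psi (Y / (B : ℝ) ^ k) y) := by
          gcongr
      _ = C * μ ^ 2 * (ρ ^ k * (X₀ / (Y / (B : ℝ) ^ k)) ^ α) * Psi (Y / (B : ℝ) ^ k) y := by
          ring
      _ = _ := by rw [h4]; ring
  have hsum := sum_le_sum hterm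
  rw [← sum_mul, ← mul_sum] at hsum
  have hgeom : μ ≤ D * ∑ k ∈ range (numBlocks B y + 1), ρ ^ k :=
    hμ.trans (saddleSum_le_geom hBn hy1 hα)
  refine le_of_mul_le_mul_left ?_ hμ0
  calc μ * (blockSum B y X₀ * log y)
      ≤ D * (∑ k ∈ range (numBlocks B y + 1), ρ ^ k) * (blockSum B y X₀ * log y) := by gcongr
    _ = D * ((∑ k ∈ range (numBlocks B y + 1), ρ ^ k) * (blockSum B y X₀ * log y)) := by ring
    _ ≤ D * (C * μ ^ 2 * (X₀ / Y) ^ α * blockSum B y Y) :=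
        mul_le_mul_of_nonneg_left hsum hD0.le
    _ = _ := by ring

lemma pow_six_mul_exp_le {k w l s μ : ℝ} (hk : 0 < k) (hw : 0 < w) (hl : 0 < l)
    (hμw : μ = w ^ 3 * l) (hws : w ^ 2 * l ≤ s) :
    w ^ 6 * exp (-(s * (s * k / (2 * μ * l)) / 2)) ≤ 720 * (4 / k) ^ 6 := by
  have hμ : 0 < μ := by rw [hμw]; positivity
  have h3 : w * k / 4 ≤ s * (s * k / (2 * μ * l)) / 2 := by
    have h4 : (w ^ 2 * l) ^ 2 ≤ s ^ 2 := by gcongr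
    have h5 : s * (s * k / (2 * μ * l)) / 2 = s ^ 2 * (k / (4 * μ * l)) := by
      field_simp
      norm_num
    rw [h5]
    calc w * k / 4 = (w ^ 2 * l) ^ 2 * (k / (4 * μ * l)) := by
          rw [hμw]
          field_simp
      _ ≤ _ := by gcongr
  have h6 := pow_div_factorial_le_exp (w * k / 4) (by positivity) 6
  have h7 := h6.trans (exp_le_exp.2 h3)
  have h9 : (Nat.factorial 6 : ℝ) = 720 := by norm_num [Nat.factorial]
  rw [h9] at h7
  rw [exp_neg, ← div_eq_mul_inv, div_le_iff₀ (exp_pos _)]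
  have h8 : w ^ 6 = 720 * (4 / k) ^ 6 * ((w * k / 4) ^ 6 / 720) := by
    field_simp
  calc w ^ 6 = 720 * (4 / k) ^ 6 * ((w * k / 4) ^ 6 / 720) := h8
    _ ≤ _ := by gcongr

/-- For large moduli the block sum at `X / Q` is smaller than expected. -/
lemma exists_blockSum_gain {B : ℕ} {c : ℝ} (hB : IsBlockBase B c) :
    ∃ C y₀ : ℝ, 0 < C ∧ (B : ℝ) ^ 2 ≤ y₀ ∧ ∀ y α μ X Q w : ℝ, y₀ ≤ y → 1 / 20 ≤ α → α ≤ 1 →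
      μ ≤ saddleSum y α → 0 < X → log X = μ → 1 ≤ Q → log Q ≤ μ → 6 / kap ≤ w →
      μ = w ^ 3 * log y → w ^ 2 * log y ≤ log Q →
      blockSum B y (X / Q) ≤ C * μ * Q ^ (-α) * Psi X y := by
  obtain ⟨C₁, y₁, hC₁, hy₁, htrans⟩ := exists_blockSum_transfer hB
  obtain ⟨C₂, y₂, hC₂, hy₂, hcomp⟩ := exists_blockSum_compare hB
  have hk := kap_pos
  have hk1 := kap_le_one
  have hB3 : (3 : ℝ) ≤ B := by exact_mod_cast hB.three_le
  refine ⟨C₂ * C₁ * (720 * (4 / kap) ^ 6), max y₁ y₂, by positivity,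
    hy₁.trans (le_max_left _ _), ?_⟩
  intro y α μ X Q w hy hα hα1 hμ hX hXμ hQ hQμ hw hμw hwQ
  have hyy₁ : y₁ ≤ y := (le_max_left _ _).trans hy
  have hyy₂ : y₂ ≤ y := (le_max_right _ _).trans hy
  have hyB : (B : ℝ) ^ 2 ≤ y := hy₁.trans hyy₁
  have hy9 : 9 ≤ y := by nlinarith
  have hy1 : 1 ≤ y := by linarith
  have hy0 : 0 < y := by linarith
  have hly : 1 ≤ log y := by
    have : log (exp 1) ≤ log y := log_le_log (exp_pos 1) (by linarith [exp_one_lt_d9])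
    rwa [log_exp] at this
  have hl4 : log 4 ≤ log y := log_le_log (by norm_num) (by linarith)
  have hkw : 6 ≤ kap * w := by rwa [div_le_iff₀' hk] at hw
  have hw6 : 6 ≤ w := by nlinarith
  have hw3 : w ≤ w ^ 3 := by nlinarith [sq_nonneg w]
  have hQ0 : 0 < Q := by linarith
  set s := log Q with hs
  have hs0 : 0 ≤ s := log_nonneg hQ
  have hμ0 : 0 < μ := by rw [hμw]; positivity
  set η := s * kap / (2 * μ * log y) with hη
  have hη0 : 0 ≤ η := by positivity
  have hηly : η * log y / kap = s / (2 * μ) := by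
    rw [hη]
    field_simp
  have hα1' : α + η ≤ 1 := by
    have h1 := hμ.trans (saddleSum_le_pow hy1 hα hα1)
    have hyp : 0 ≤ y ^ (1 - α) := by positivity
    have h2 : μ ≤ kap⁻¹ * y ^ (1 - α) * (2 * log y) := h1.trans (by gcongr; linarith)
    have h3 : exp 1 ≤ y ^ (1 - α) := by
      rw [hμw] at h2
      have h4 : w ^ 3 * log y ≤ (2 * kap⁻¹ * y ^ (1 - α)) * log y := by linarith
      have h5 : w ^ 3 ≤ 2 * kap⁻¹ * y ^ (1 - α) := le_of_mul_le_mul_right h4 (by linarith)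
      have h6 : kap * w ^ 3 ≤ 2 * y ^ (1 - α) := by
        calc kap * w ^ 3 ≤ kap * (2 * kap⁻¹ * y ^ (1 - α)) := by gcongr
          _ = _ := by field_simp
      have h7 : kap * w ≤ kap * w ^ 3 := by gcongr
      linarith [exp_one_lt_d9]
    have h8 : 1 ≤ (1 - α) * log y := by
      have := log_le_log (exp_pos 1) h3
      rwa [log_exp, log_rpow hy0] at this
    have h9 : η * log y ≤ 1 := by
      have : η * log y = s / (2 * μ) * kap := by rw [← hηly]; field_simp
      rw [this]
      have h10 : s / (2 * μ) ≤ 1 := by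
        rw [div_le_one (by positivity)]
        linarith
      have : 0 ≤ s / (2 * μ) := by positivity
      nlinarith
    have h11 : η * log y ≤ (1 - α) * log y := by linarith
    have := le_of_mul_le_mul_right h11 (by linarith)
    linarith
  have hsad : μ - s / 2 ≤ saddleSum y (α + η) := by
    refine le_trans ?_ (saddleSum_add_ge hy1 hα hη0)
    rw [hηly]
    have h1 : s / (2 * μ) ≤ 1 := by
      rw [div_le_one (by positivity)]
      linarith
    calc μ - s / 2 = μ * (1 - s / (2 * μ)) := by field_simp
      _ ≤ _ := by gcongr
  set T := Q ^ (-(1 / 2) : ℝ) with hT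
  have hT0 : 0 < T := by positivity
  have hlT : log T = -(s / 2) := by rw [hT, log_rpow hQ0, ← hs]; ring
  have hTT : T * T = Q⁻¹ := by
    rw [hT, ← rpow_add hQ0, ← rpow_neg_one]
    norm_num
  have hlX₁ : log (X * T) = μ - s / 2 := by
    rw [log_mul hX.ne' hT0.ne', hlT, hXμ]
    ring
  have hw3ly : 2 * log y ≤ μ := by
    rw [hμw]
    have : 2 ≤ w ^ 3 := by linarith
    gcongr
  have hw2ly : 2 * log y ≤ s := by
    refine le_trans ?_ hwQ
    have : 2 ≤ w ^ 2 := by nlinarith only [hw6]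
    gcongr
  have hTy : T * y ≤ 1 := by
    rw [← log_nonpos_iff (by positivity), log_mul hT0.ne' hy0.ne', hlT]
    linarith
  have hT1 : T ≤ 1 := (le_mul_of_one_le_right hT0.le hy1).trans hTy
  have hratio : X / Q / (X * T) = T := by
    rw [div_eq_mul_inv X Q, ← hTT]
    field_simp
  have hXQ : X / Q * y ≤ X * T := by
    rw [div_eq_mul_inv, ← hTT]
    calc X * (T * T) * y = X * T * (T * y) := by ring
      _ ≤ X * T * 1 := by gcongr
      _ = _ := mul_one _
  have h1 := hcomp y (α + η) (μ - s / 2) (X / Q) (X * T) hyy₂ (by linarith) hα1'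
    (by linarith) hsad (by positivity) hXQ hlX₁.le
  rw [hratio] at h1
  have h2 := htrans y α μ (X * T) X hyy₁ hα hα1 (by linarith) hμ (by positivity)
    (mul_le_of_le_one_right hX.le hT1) hXμ.le
  rw [mul_div_cancel_left₀ _ hX.ne'] at h2
  have hΘ0 : 0 ≤ blockSum B y (X / Q) := sum_nonneg fun k _ => by positivity
  have hΘ1 : 0 ≤ blockSum B y (X * T) := sum_nonneg fun k _ => by positivity
  have hexp : T ^ (α + η) * T ^ α = Q ^ (-α) * exp (-(s * η / 2)) := by
    rw [← rpow_add hT0, rpow_def_of_pos hT0, hlT, rpow_def_of_pos hQ0, ← exp_add, ← hs]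
    congr 1
    ring
  have hgain := pow_six_mul_exp_le hk (by linarith : 0 < w) (by linarith) hμw hwQ
  rw [← hη] at hgain
  have hμs : 0 ≤ μ - s / 2 := by linarith
  refine le_of_mul_le_mul_right ?_ (by positivity : 0 < log y ^ 2)
  calc blockSum B y (X / Q) * log y ^ 2 = blockSum B y (X / Q) * log y * log y := by ring
    _ ≤ C₂ * (μ - s / 2) * T ^ (α + η) * blockSum B y (X * T) * log y := by gcongr
    _ ≤ C₂ * μ * T ^ (α + η) * blockSum B y (X * T) * log y := by
      gcongr
      linarith
    _ = C₂ * μ * T ^ (α + η) * (blockSum B y (X * T) * log y) := by ring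
    _ ≤ C₂ * μ * T ^ (α + η) * (C₁ * μ ^ 2 * T ^ α * Psi X y) := by gcongr
    _ = C₂ * C₁ * μ * μ ^ 2 * (T ^ (α + η) * T ^ α) * Psi X y := by ring
    _ = C₂ * C₁ * (w ^ 6 * exp (-(s * η / 2))) * μ * Q ^ (-α) * Psi X y * log y ^ 2 := by
      rw [hexp]
      nth_rewrite 2 [hμw]
      ring
    _ ≤ C₂ * C₁ * (720 * (4 / kap) ^ 6) * μ * Q ^ (-α) * Psi X y * log y ^ 2 := by gcongr

lemma coprime_div_gcd {q a : ℕ} (hq : 0 < q) : (a / a.gcd q).Coprime (q / a.gcd q) :=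
  Nat.coprime_div_gcd_div_gcd (Nat.gcd_pos_of_pos_right a hq)

lemma card_residue_le_card_coprime {q a : ℕ} (hq : 0 < q) (X y : ℝ) :
    ((smoothUpTo X y).filter (· ≡ a [MOD q])).card ≤
      ((smoothUpTo (X / a.gcd q) y).filter (· ≡ a / a.gcd q [MOD q / a.gcd q])).card := by
  set d := a.gcd q with hd
  have hd0 : 0 < d := Nat.gcd_pos_of_pos_right a hq
  have hda : d ∣ a := Nat.gcd_dvd_left a q
  have hdq : d ∣ q := Nat.gcd_dvd_right a q
  have hdn : ∀ n, n ≡ a [MOD q] → d ∣ n := fun n hn => (hn.dvd_iff hdq).2 hda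
  refine card_le_card_of_injOn (· / d) ?_ ?_
  · intro n hn
    simp only [coe_filter, Set.mem_ofPred_eq, mem_smoothUpTo] at hn ⊢
    obtain ⟨⟨hn1, hnX, hns⟩, hna⟩ := hn
    obtain ⟨m, rfl⟩ := hdn n hna
    rw [Nat.mul_div_cancel_left _ hd0]
    refine ⟨⟨Nat.pos_of_ne_zero fun h => by simp [h] at hn1, ?_,
      isSmooth_of_dvd hns (Dvd.intro_left _ rfl)⟩, ?_⟩
    · rw [le_div_iff₀ (by exact_mod_cast hd0)]
      push_cast at hnX
      linarith
    · refine Nat.ModEq.mul_left_cancel' hd0.ne' ?_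
      rwa [Nat.mul_div_cancel' hda, Nat.mul_div_cancel' hdq]
  · intro n hn m hm h
    simp only [coe_filter, Set.mem_ofPred_eq] at hn hm h
    rw [← Nat.div_mul_cancel (hdn n hn.2), ← Nat.div_mul_cancel (hdn m hm.2), h]

lemma div_gcd_div_div_gcd (q a : ℕ) (X : ℝ) :
    X / (a.gcd q : ℕ) / (q / a.gcd q : ℕ) = X / q := by
  have h : ((a.gcd q : ℕ) : ℝ) * ((q / a.gcd q : ℕ) : ℝ) = q := by
    exact_mod_cast Nat.mul_div_cancel' (Nat.gcd_dvd_right a q)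
  rw [div_div, h]

lemma card_residue_le {B q : ℕ} {y : ℝ} (hB : 1 < B) (hq : 0 < q) (hy : 1 ≤ y) (a : ℕ) (X : ℝ) :
    ((((smoothUpTo X y).filter (· ≡ a [MOD q])).card : ℕ) : ℝ) ≤
      1 + B * blockSum B y (X / q) := by
  have hd0 : 0 < a.gcd q := Nat.gcd_pos_of_pos_right a hq
  have h1 := card_coprime_residue_le (Z := X / a.gcd q) hB
    (Nat.div_pos (Nat.le_of_dvd hq (Nat.gcd_dvd_right a q)) hd0) hy (coprime_div_gcd hq (a := a))
  rw [div_gcd_div_div_gcd q a] at h1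
  refine le_trans ?_ h1
  exact_mod_cast card_residue_le_card_coprime hq X y

/-- Counting the smooth numbers in a reduced residue class which are large and not divisible by
large prime powers. -/
lemma card_regular_le {B q a : ℕ} {y Z w μ E : ℝ} (hB : 1 < B) (hq : 0 < q) (hy : 1 < y)
    (hqa : a.Coprime q) (hw : 0 < w) (hμ : μ = w ^ 3 * log y)
    (hqw : log q ≤ w ^ 2 * log y) (hE : B * blockSum B y (Z / q) ≤ w ^ 3 * E) (hE0 : 0 ≤ E)
    {S : Finset ℕ} (hS : ∀ n ∈ S, n ∈ smoothUpTo Z y ∧ n ≡ a [MOD q])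
    (hSq : ∀ n ∈ S, q ≤ n)
    (hSW : ∀ n ∈ S, ∀ p ∈ primesUpTo y, ((p ^ n.factorization p : ℕ) : ℝ) ≤ q * y ^ 20)
    (hSlog : ∀ n ∈ S, μ / 4 ≤ log n) :
    (S.card : ℝ) ≤ 8 * 264 ^ 3 * E := by
  have hq1 : (1 : ℝ) ≤ q := by exact_mod_cast hq
  have hly : 0 < log y := log_pos hy
  have hlq : 0 ≤ log (q : ℝ) := log_nonneg hq1
  have hμ0 : 0 < μ := by rw [hμ]; positivity
  have hy0 : 0 < y := by linarith
  have hlqy : log (q * y) = log q + log y := log_mul (by linarith) hy0.ne'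
  have hlW : log (q * y ^ 20) = log q + 20 * log y := by
    rw [log_mul (by linarith) (by positivity), log_pow]
    norm_num
  have hqy1 : 1 ≤ q * y := by nlinarith
  have hBs : 0 ≤ B * blockSum B y (Z / q) :=
    mul_nonneg (by positivity) (sum_nonneg fun k _ => by positivity)
  rcases lt_or_ge (log q) (2 * log y) with hcase | hcase
  · have hlow : ∀ n ∈ S, μ / 176 ≤ truncLog y (q * y) n := by
      intro n hn
      obtain ⟨hn1, -, hns⟩ := mem_smoothUpTo.1 (hS n hn).1
      have h1 := le_truncLog (z := q * y) (c := 1 / 44) hy.le (by nlinarith) hns (by norm_num)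
        (by norm_num) (by rw [hlW, hlqy]; linarith) (hSW n hn)
      linarith [hSlog n hn]
    have h2 := card_mul_pow_le (r := 1) hB hq hy.le hqa (by linarith : 0 ≤ q * y)
      (by rw [pow_one]) (by positivity) hS hSq hlow
    rw [pow_one, pow_one, hlqy] at h2
    have h3 : (S.card : ℝ) * (μ / 176) ≤ 528 * E * (μ / 176) := by
      calc (S.card : ℝ) * (μ / 176) ≤ (log q + log y) * (B * blockSum B y (Z / q)) := h2
        _ ≤ (3 * log y) * (w ^ 3 * E) := by
          gcongr
          linarith
        _ = 528 * E * (μ / 176) := by rw [hμ]; ring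
    have h4 := le_of_mul_le_mul_right h3 (by positivity)
    linarith
  · set z := (q * y) ^ ((1 : ℝ) / 3) with hz
    have hz0 : 0 ≤ z := by positivity
    have hz3 : z ^ 3 = q * y := by
      rw [hz, ← rpow_natCast, ← rpow_mul (by linarith)]
      norm_num
    have hlz : log z = (log q + log y) / 3 := by
      rw [hz, log_rpow (by linarith), hlqy]
      ring
    have hyz : y ≤ z := by
      rw [← log_le_log_iff hy0 (by positivity), hlz]
      linarith
    have hlow : ∀ n ∈ S, μ / 264 ≤ truncLog y z n := by
      intro n hn
      obtain ⟨hn1, -, hns⟩ := mem_smoothUpTo.1 (hS n hn).1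
      have h1 := le_truncLog (z := z) (c := 1 / 66) hy.le hyz hns (by norm_num)
        (by norm_num) (by rw [hlW, hlz]; linarith) (hSW n hn)
      linarith [hSlog n hn]
    have h2 := card_mul_pow_le (r := 3) hB hq hy.le hqa hz0 hz3.le (by positivity) hS hSq hlow
    rw [hlqy] at h2
    have h3 : (S.card : ℝ) * (μ / 264) ^ 3 ≤ 8 * 264 ^ 3 * E * (μ / 264) ^ 3 := by
      calc (S.card : ℝ) * (μ / 264) ^ 3 ≤ (log q + log y) ^ 3 * (B * blockSum B y (Z / q)) := h2
        _ ≤ (2 * (w ^ 2 * log y)) ^ 3 * (w ^ 3 * E) := by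
          gcongr
          linarith
        _ = 8 * 264 ^ 3 * E * (μ / 264) ^ 3 := by rw [hμ]; ring
    exact le_of_mul_le_mul_right h3 (by positivity)

/-- The count in a residue class to a modulus which is not too large. -/
lemma exists_card_coprime_le {B : ℕ} {c : ℝ} (hB : IsBlockBase B c) :
    ∃ C y₀ : ℝ, 0 < C ∧ (B : ℝ) ^ 2 ≤ y₀ ∧ ∀ (y α μ X w : ℝ) (q d a : ℕ), y₀ ≤ y →
      1 / 20 ≤ α → α ≤ 1 → μ ≤ saddleSum y α → 0 < X → log X = μ → 0 < q → 0 < d →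
      a.Coprime q → 4 ≤ w → μ = w ^ 3 * log y → log (d * q) ≤ w ^ 2 * log y →
      (((smoothUpTo (X / d) y).filter (· ≡ a [MOD q])).card : ℝ) ≤
        C * μ * (d * q : ℝ) ^ (-α) * Psi X y + 2 := by
  obtain ⟨C₁, y₁, hC₁, hy₁, htrans⟩ := exists_blockSum_transfer hB
  obtain ⟨C₂, y₂, hC₂, hy₂, hpsi⟩ := exists_Psi_transfer hB
  have hB3 : (3 : ℝ) ≤ B := by exact_mod_cast hB.three_le
  have hBn : 1 < B := by have := hB.three_le; omega
  refine ⟨B * (40 * C₁) + 2 * C₂ + 8 * 264 ^ 3 * (B * C₁), max y₁ y₂, by positivity,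
    hy₁.trans (le_max_left _ _), ?_⟩
  intro y α μ X w q d a hy hα hα1 hμ hX hXμ hq hd hqa hw hμw hqw
  have hyy₁ : y₁ ≤ y := (le_max_left _ _).trans hy
  have hyy₂ : y₂ ≤ y := (le_max_right _ _).trans hy
  have hyB : (B : ℝ) ^ 2 ≤ y := hy₁.trans hyy₁
  have hy9 : 9 ≤ y := by nlinarith only [hyB, hB3]
  have hy1 : 1 ≤ y := by linarith
  have hy0 : 0 < y := by linarith
  have hly : 1 ≤ log y := by
    have : log (exp 1) ≤ log y := log_le_log (exp_pos 1) (by linarith [exp_one_lt_d9])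
    rwa [log_exp] at this
  have hq1 : (1 : ℝ) ≤ q := by exact_mod_cast hq
  have hd1 : (1 : ℝ) ≤ d := by exact_mod_cast hd
  have hw3 : 4 * w ^ 2 ≤ w ^ 3 := by
    rw [pow_succ' w 2]
    gcongr
  have hw1 : 1 ≤ w ^ 3 := one_le_pow₀ (by linarith)
  have hμ0 : 0 < μ := by rw [hμw]; positivity
  have hlyμ : log y ≤ μ := by
    rw [hμw]
    exact le_mul_of_one_le_left (by linarith) hw1
  set Q : ℝ := d * q with hQ
  have hQ1 : 1 ≤ Q := one_le_mul_of_one_le_of_one_le hd1 hq1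
  have hQ0 : 0 < Q := by linarith
  have hlQ : log Q = log d + log q := log_mul (by linarith) (by linarith)
  have hld : 0 ≤ log (d : ℝ) := log_nonneg hd1
  have hlq : 0 ≤ log (q : ℝ) := log_nonneg hq1
  have hlQμ : log Q ≤ μ / 4 := by
    refine hqw.trans ?_
    rw [hμw]
    have : 4 * w ^ 2 * log y ≤ w ^ 3 * log y := by gcongr
    linarith
  set P := (Psi X y : ℝ) with hP
  have hP0 : 0 ≤ P := Nat.cast_nonneg _
  have hQα : 0 ≤ Q ^ (-α) := by positivity
  have hQinv : (1 / Q) ^ α = Q ^ (-α) := by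
    rw [one_div, inv_rpow hQ0.le, rpow_neg hQ0.le]
  have hZq : X / d / q = X / Q := by rw [div_div]
  have hbase : B * blockSum B y (X / d / q) ≤ w ^ 3 * (B * C₁ * μ * Q ^ (-α) * P) := by
    have h1 := htrans y α μ (X / Q) X hyy₁ hα hα1 hlyμ hμ (by positivity)
      (div_le_self hX.le hQ1) hXμ.le
    rw [show X / Q / X = 1 / Q by field_simp, hQinv] at h1
    rw [hZq]
    refine le_of_mul_le_mul_right ?_ (by linarith : 0 < log y)
    calc B * blockSum B y (X / Q) * log y = B * (blockSum B y (X / Q) * log y) := by ring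
      _ ≤ B * (C₁ * μ ^ 2 * Q ^ (-α) * P) := by gcongr
      _ = B * C₁ * μ * Q ^ (-α) * P * μ := by ring
      _ = B * C₁ * μ * Q ^ (-α) * P * (w ^ 3 * log y) := by rw [← hμw]
      _ = _ := by ring
  set R := X ^ ((1 : ℝ) / 2) with hR
  have hR0 : 0 < R := by positivity
  have hlR : log R = μ / 2 := by
    rw [hR, log_rpow hX, hXμ]
    ring
  have hRX : R ≤ X := by
    rw [← log_le_log_iff hR0 hX, hlR, hXμ]
    linarith
  have hsmall : B * blockSum B y (R / Q) ≤ B * (40 * C₁) * μ * Q ^ (-α) * P := by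
    have h1 := htrans y α μ (R / Q) X hyy₁ hα hα1 hlyμ hμ (by positivity)
      ((div_le_self hR0.le hQ1).trans hRX) hXμ.le
    have h2 : (R / Q / X) ^ α ≤ 40 / μ * Q ^ (-α) := by
      have h3 : R / Q / X = R / X * (1 / Q) := by field_simp
      rw [h3, mul_rpow (by positivity) (by positivity), hQinv]
      have h4 : (R / X) ^ α = (exp (α * μ / 2))⁻¹ := by
        rw [rpow_def_of_pos (by positivity), log_div hR0.ne' hX.ne', hlR, hXμ, ← exp_neg]
        congr 1
        ring
      have h5 : μ / 40 ≤ exp (α * μ / 2) := by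
        have h6 := add_one_le_exp (α * μ / 2)
        have h7 : 1 / 20 * μ ≤ α * μ := by gcongr
        linarith
      have h8 : (exp (α * μ / 2))⁻¹ ≤ 40 / μ := by
        rw [← inv_div μ 40]
        exact inv_anti₀ (by positivity) h5
      rw [h4]
      gcongr
    have hΘ : 0 ≤ blockSum B y (R / Q) := sum_nonneg fun k _ => by positivity
    calc B * blockSum B y (R / Q) = B * (blockSum B y (R / Q) * 1) := by ring
      _ ≤ B * (blockSum B y (R / Q) * log y) := by gcongr
      _ ≤ B * (C₁ * μ ^ 2 * (R / Q / X) ^ α * P) := by gcongr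
      _ ≤ B * (C₁ * μ ^ 2 * (40 / μ * Q ^ (-α)) * P) := by gcongr
      _ = _ := by field_simp
  set W : ℝ := q * y ^ 20 with hW
  have hW1 : 1 ≤ W := one_le_mul_of_one_le_of_one_le hq1 (one_le_pow₀ hy1)
  have hbadΨ : 2 * y * Psi (X / d / W) y ≤ 2 * C₂ * μ * Q ^ (-α) * P := by
    have hZW : X / d / W = X / (Q * y ^ 20) := by
      rw [div_div, hW, hQ]
      congr 1
      ring
    have hy20 : 1 ≤ y ^ 20 := one_le_pow₀ hy1
    have h1 := hpsi y α μ (X / (Q * y ^ 20)) X hyy₂ hα hα1 hlyμ hμ (by positivity)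
      (div_le_self hX.le (one_le_mul_of_one_le_of_one_le hQ1 hy20)) hXμ.le
    have h2 : (X / (Q * y ^ 20) / X) ^ α ≤ Q ^ (-α) * y⁻¹ := by
      have h3 : X / (Q * y ^ 20) / X = 1 / Q * (y ^ 20)⁻¹ := by field_simp
      rw [h3, mul_rpow (by positivity) (by positivity), hQinv]
      have h4 : ((y ^ 20)⁻¹) ^ α ≤ y⁻¹ := by
        rw [← rpow_natCast, ← rpow_neg hy0.le, ← rpow_mul hy0.le, ← rpow_neg_one]
        refine rpow_le_rpow_of_exponent_le hy1 ?_
        push_cast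
        linarith
      gcongr
    rw [hZW]
    calc 2 * y * Psi (X / (Q * y ^ 20)) y
        ≤ 2 * y * (C₂ * μ * (X / (Q * y ^ 20) / X) ^ α * P) := by gcongr
      _ ≤ 2 * y * (C₂ * μ * (Q ^ (-α) * y⁻¹) * P) := by gcongr
      _ = _ := by field_simp
  set S := (smoothUpTo (X / d) y).filter (· ≡ a [MOD q]) with hS
  have hSmem : ∀ n ∈ S, n ∈ smoothUpTo (X / d) y ∧ n ≡ a [MOD q] := fun n hn => by
    simpa [hS] using hn
  set S₁ := S.filter fun n : ℕ => (n : ℝ) ≤ R / d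
  set S₂ := S.filter (· < q)
  set S₃ := S.filter fun n : ℕ => ∃ p ∈ primesUpTo y, W < ((p ^ n.factorization p : ℕ) : ℝ)
  set S₄ := S.filter fun n : ℕ => R / d < (n : ℝ) ∧ q ≤ n ∧
    ∀ p ∈ primesUpTo y, ((p ^ n.factorization p : ℕ) : ℝ) ≤ W
  have hcover : S ⊆ S₁ ∪ (S₂ ∪ (S₃ ∪ S₄)) := by
    intro n hn
    simp only [S₁, S₂, S₃, S₄, mem_union, mem_filter, hn, true_and]
    by_contra! h
    obtain ⟨h1, h2, h3, h4⟩ := h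
    obtain ⟨p, hp, hpW⟩ := h4 h1 h2
    exact absurd (h3 p hp) (not_le.2 hpW)
  have hcard : (S.card : ℝ) ≤ S₁.card + (S₂.card + (S₃.card + S₄.card)) := by
    have h1 := (card_le_card hcover).trans (card_union_le _ _)
    have h2 := card_union_le S₂ (S₃ ∪ S₄)
    have h3 := card_union_le S₃ S₄
    exact_mod_cast (by omega : S.card ≤ S₁.card + (S₂.card + (S₃.card + S₄.card)))
  have hS₁ : (S₁.card : ℝ) ≤ 1 + B * (40 * C₁) * μ * Q ^ (-α) * P := by
    have h1 := card_coprime_residue_le (Z := R / d) hBn hq hy1 hqa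
    rw [div_div] at h1
    have h2 : S₁ ⊆ (smoothUpTo (R / d) y).filter (· ≡ a [MOD q]) := by
      intro n hn
      simp only [S₁, hS, mem_filter, mem_smoothUpTo] at hn ⊢
      exact ⟨⟨hn.1.1.1, hn.2, hn.1.1.2.2⟩, hn.1.2⟩
    have h3 : (S₁.card : ℝ) ≤ ((smoothUpTo (R / d) y).filter (· ≡ a [MOD q])).card := by
      exact_mod_cast card_le_card h2
    linarith
  have hS₂ : (S₂.card : ℝ) ≤ 1 := by
    exact_mod_cast card_lt_modulus_le_one (a := a) fun n hn => by
      simp only [S₂, mem_filter] at hn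
      exact ⟨(hSmem n hn.1).2, hn.2⟩
  have hS₃ : (S₃.card : ℝ) ≤ 2 * C₂ * μ * Q ^ (-α) * P := by
    refine (card_large_prime_power_le hy1 (by positivity) hW1
      ((filter_subset _ _).trans (filter_subset _ _)) fun n hn => ?_).trans hbadΨ
    simp only [mem_filter] at hn
    exact hn.2
  have hS₄ : (S₄.card : ℝ) ≤ 8 * 264 ^ 3 * (B * C₁ * μ * Q ^ (-α) * P) := by
    have hmem : ∀ n ∈ S₄, n ∈ S ∧ R / d < (n : ℝ) ∧ q ≤ n ∧
        ∀ p ∈ primesUpTo y, ((p ^ n.factorization p : ℕ) : ℝ) ≤ W := fun n hn => by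
      simpa only [S₄, mem_filter] using hn
    refine card_regular_le hBn hq (by linarith) hqa (by linarith) hμw (by linarith) hbase
      (by positivity) (fun n hn => hSmem n (hmem n hn).1) (fun n hn => (hmem n hn).2.2.1)
      (fun n hn => (hmem n hn).2.2.2) fun n hn => ?_
    have h1 := log_le_log (by positivity) (hmem n hn).2.1.le
    rw [log_div hR0.ne' (by linarith), hlR] at h1
    linarith
  calc (S.card : ℝ) ≤ S₁.card + (S₂.card + (S₃.card + S₄.card)) := hcard
    _ ≤ (1 + B * (40 * C₁) * μ * Q ^ (-α) * P) + (1 + (2 * C₂ * μ * Q ^ (-α) * P +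
          8 * 264 ^ 3 * (B * C₁ * μ * Q ^ (-α) * P))) :=
        add_le_add hS₁ (add_le_add hS₂ (add_le_add hS₃ hS₄))
    _ = _ := by ring

/-- Upper bound for the number of smooth integers in a residue class. -/
lemma exists_card_residue_le {B : ℕ} {c : ℝ} (hB : IsBlockBase B c) :
    ∃ C y₀ : ℝ, 0 < C ∧ ∀ (y α μ X : ℝ) (q a : ℕ), y₀ ≤ y → 1 / 20 ≤ α → α ≤ 1 →
      log y ≤ μ → μ ≤ saddleSum y α → 0 < X → log X = μ → 0 < q → log q ≤ μ →
      (((smoothUpTo X y).filter (· ≡ a [MOD q])).card : ℝ) ≤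
        C * (μ * (q : ℝ) ^ (-α) * Psi X y + y) := by
  obtain ⟨C₁, y₁, hC₁, hy₁, htrans⟩ := exists_blockSum_transfer hB
  obtain ⟨C₂, y₂, hC₂, hy₂, hgain⟩ := exists_blockSum_gain hB
  obtain ⟨C₃, y₃, hC₃, hy₃, hsmall⟩ := exists_card_coprime_le hB
  have hk := kap_pos
  have hk1 := kap_le_one
  have hB3 : (3 : ℝ) ≤ B := by exact_mod_cast hB.three_le
  have hBn : 1 < B := by have := hB.three_le; omega
  have hk4 : 4 ≤ 6 / kap := by
    rw [le_div_iff₀ hk]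
    linarith
  set C := B * C₁ * (6 / kap) ^ 3 + B * C₂ + C₃ + 2 with hC
  have hA₁ : 0 < B * C₁ * (6 / kap) ^ 3 := by positivity
  have hA₂ : 0 < B * C₂ := by positivity
  refine ⟨C, max y₁ (max y₂ y₃), by positivity, ?_⟩
  intro y α μ X q a hy hα hα1 hyμ hμ hX hXμ hq hqμ
  have hyy₁ : y₁ ≤ y := (le_max_left _ _).trans hy
  have hyy₂ : y₂ ≤ y := (le_max_left _ _).trans ((le_max_right _ _).trans hy)
  have hyy₃ : y₃ ≤ y := (le_max_right _ _).trans ((le_max_right _ _).trans hy)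
  have hyB : (B : ℝ) ^ 2 ≤ y := hy₁.trans hyy₁
  have hy9 : 9 ≤ y := by nlinarith only [hyB, hB3]
  have hy1 : 1 ≤ y := by linarith
  have hly : 0 < log y := log_pos (by linarith)
  have hq1 : (1 : ℝ) ≤ q := by exact_mod_cast hq
  have hμ0 : 0 < μ := by linarith
  set w := (μ / log y) ^ ((1 : ℝ) / 3) with hw
  have hw0 : 0 ≤ w := by positivity
  have hw3 : w ^ 3 = μ / log y := by
    rw [hw, ← rpow_natCast, ← rpow_mul (by positivity)]
    norm_num
  have hμw : μ = w ^ 3 * log y := by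
    rw [hw3]
    field_simp
  set F := μ * (q : ℝ) ^ (-α) * Psi X y with hF
  have hF0 : 0 ≤ F := by positivity
  have hfin : ∀ A : ℝ, A + 2 ≤ C → ∀ N : ℝ, N ≤ A * F + 2 → N ≤ C * (F + y) := by
    intro A hA N hN
    have h1 : A * F ≤ C * F := by gcongr; linarith
    have h2 : 2 ≤ C * y := by
      have : 2 * 1 ≤ C * y := by gcongr; linarith
      linarith
    linarith
  rcases lt_or_ge w (6 / kap) with hcase | hcase
  · have h1 := htrans y α μ (X / q) X hyy₁ hα hα1 hyμ hμ (by positivity)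
      (div_le_self hX.le hq1) hXμ.le
    have hQ : (X / q / X) ^ α = (q : ℝ) ^ (-α) := by
      rw [show X / q / X = (q : ℝ)⁻¹ by field_simp, inv_rpow (by linarith),
        rpow_neg (by linarith)]
    rw [hQ] at h1
    have h2 : blockSum B y (X / q) ≤ C₁ * w ^ 3 * F := by
      refine le_of_mul_le_mul_right ?_ hly
      calc _ ≤ _ := h1
        _ = C₁ * μ * F := by rw [hF]; ring
        _ = C₁ * (w ^ 3 * log y) * F := by rw [← hμw]
        _ = _ := by ring
    have h3 := card_residue_le hBn hq hy1 a X
    refine hfin (B * C₁ * (6 / kap) ^ 3) (by linarith) _ (h3.trans ?_)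
    have h4 : B * blockSum B y (X / q) ≤ B * (C₁ * (6 / kap) ^ 3 * F) := by
      gcongr
      exact h2.trans (by gcongr)
    linarith
  · rcases le_or_gt (w ^ 2 * log y) (log q) with hcase2 | hcase2
    · have h1 := hgain y α μ X q w hyy₂ hα hα1 hμ hX hXμ hq1 hqμ hcase hμw hcase2
      have h3 := card_residue_le hBn hq hy1 a X
      refine hfin (B * C₂) (by linarith) _ (h3.trans ?_)
      have h4 : B * blockSum B y (X / q) ≤ B * (C₂ * F) := by
        gcongr
        refine h1.trans (le_of_eq ?_)
        rw [hF]
        ring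
      linarith
    · have hd0 : 0 < a.gcd q := Nat.gcd_pos_of_pos_right a hq
      have hdq : ((a.gcd q : ℕ) : ℝ) * ((q / a.gcd q : ℕ) : ℝ) = q := by
        exact_mod_cast Nat.mul_div_cancel' (Nat.gcd_dvd_right a q)
      have h1 := hsmall y α μ X w (q / a.gcd q) (a.gcd q) (a / a.gcd q) hyy₃ hα hα1 hμ hX hXμ
        (Nat.div_pos (Nat.le_of_dvd hq (Nat.gcd_dvd_right a q)) hd0) hd0 (coprime_div_gcd hq)
        (hk4.trans hcase) hμw (by rw [hdq]; exact hcase2.le)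
      rw [hdq] at h1
      refine hfin C₃ (by linarith) _ ?_
      have h2 : (((smoothUpTo X y).filter (· ≡ a [MOD q])).card : ℝ) ≤
          ((smoothUpTo (X / a.gcd q) y).filter
            (· ≡ a / a.gcd q [MOD q / a.gcd q])).card := by
        exact_mod_cast card_residue_le_card_coprime hq X y
      refine (h2.trans h1).trans (le_of_eq ?_)
      rw [hF]
      ring

lemma card_residue_le_div_add_one {q : ℕ} (hq : 0 < q) (a : ℕ) {X : ℝ} (hX : 0 ≤ X) (y : ℝ) :
    (((smoothUpTo X y).filter (· ≡ a [MOD q])).card : ℝ) ≤ X / q + 1 := by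
  have hqR : (0 : ℝ) < q := by exact_mod_cast hq
  have h1 : ((smoothUpTo X y).filter (· ≡ a [MOD q])).card ≤ (range (⌊X / q⌋₊ + 1)).card := by
    refine card_le_card_of_injOn (· / q) ?_ ?_
    · intro n hn
      simp only [coe_filter, Set.mem_ofPred_eq, mem_smoothUpTo] at hn
      simp only [coe_range, Set.mem_Iio, Nat.lt_succ_iff]
      refine Nat.le_floor (Nat.cast_div_le.trans ?_)
      have := hn.1.2.1
      gcongr
    · intro n hn m hm h
      simp only [coe_filter, Set.mem_ofPred_eq] at hn hm h
      have hmod : n % q = m % q := hn.2.trans hm.2.symm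
      rw [← Nat.div_add_mod n q, ← Nat.div_add_mod m q, h, hmod]
  rw [card_range] at h1
  have h2 : (((smoothUpTo X y).filter (· ≡ a [MOD q])).card : ℝ) ≤ (⌊X / q⌋₊ : ℝ) + 1 := by
    exact_mod_cast h1
  linarith [Nat.floor_le (by positivity : 0 ≤ X / q)]

lemma Tcount_le {y X M : ℝ} {r b : ℕ}
    (hM : ∀ a : ℕ, (((smoothUpTo X y).filter (· ≡ a [MOD r])).card : ℝ) ≤ M) :
    (Tcount y X r b : ℝ) ≤ Psi X y * M := by
  have h1 : {nn : ℕ × ℕ | 1 ≤ nn.1 ∧ 1 ≤ nn.2 ∧ (nn.1 : ℝ) ≤ X ∧ (nn.2 : ℝ) ≤ X ∧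
      IsSmooth y nn.1 ∧ IsSmooth y nn.2 ∧ nn.1 ≡ nn.2 + b [MOD r]} =
      ((smoothUpTo X y ×ˢ smoothUpTo X y).filter fun nn => nn.1 ≡ nn.2 + b [MOD r] :
        Finset (ℕ × ℕ)) := by
    ext nn
    simp only [Set.mem_ofPred_eq, coe_filter, mem_product, mem_smoothUpTo]
    tauto
  have h2 : ((smoothUpTo X y ×ˢ smoothUpTo X y).filter fun nn => nn.1 ≡ nn.2 + b [MOD r]).card ≤
      ((smoothUpTo X y).sigma fun n₂ =>
        (smoothUpTo X y).filter (· ≡ n₂ + b [MOD r])).card := by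
    refine card_le_card_of_injOn (fun nn => ⟨nn.2, nn.1⟩) ?_ ?_
    · intro nn hnn
      simp only [coe_filter, mem_product, Set.mem_ofPred_eq] at hnn
      simp only [mem_coe, mem_sigma, mem_filter]
      tauto
    · intro nn _ mm _ h
      simp only [Sigma.mk.injEq, heq_eq_eq] at h
      exact Prod.ext h.2 h.1
  have h3 : (Tcount y X r b : ℝ) ≤ ((smoothUpTo X y).sigma fun n₂ =>
      (smoothUpTo X y).filter (· ≡ n₂ + b [MOD r])).card := by
    rw [Tcount, h1, Nat.card_coe_set_eq, Set.ncard_coe_finset]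
    exact_mod_cast h2
  refine h3.trans ?_
  rw [card_sigma, Psi_eq_card, ← nsmul_eq_mul]
  push_cast
  exact sum_le_card_nsmul _ _ _ fun n _ => hM (n + b)

/-- For admissible `x` and `y`, the smooth integers up to any `X ≤ x` in a residue class
modulo `q` number at most a constant times `Ψ(X, y) q ^ (-α) log x + y`. -/
lemma exists_card_residue_le_of_alphaEq :
    ∃ C : ℝ, 0 < C ∧ ∀ (x y α X : ℝ) (q a : ℕ), 3 ≤ x → log x ^ (1.1 : ℝ) ≤ y →
      y ≤ x ^ ((1 : ℝ) / 3) → alphaEq x y α → 0 < q → 0 < X → X ≤ x →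
      (((smoothUpTo X y).filter (· ≡ a [MOD q])).card : ℝ) ≤
        C * (Psi X y * (q : ℝ) ^ (-α) * log x + y) := by
  obtain ⟨B, c, h₁, h₂, h₃, h₄⟩ := exists_theta_block
  have hB : IsBlockBase B c := ⟨h₁, h₂, h₃, h₄⟩
  obtain ⟨y₁, hα⟩ := exists_alpha_bounds
  obtain ⟨C₁, y₂, hC₁, hmain⟩ := exists_card_residue_le hB
  set y₀ : ℝ := max y₁ y₂ with hy₀
  refine ⟨C₁ + exp y₀ + 2, by positivity, ?_⟩
  intro x y α X q a hx hxy hyx hxα hq hX hXx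
  have hl3 : 1 ≤ log x := by
    rw [le_log_iff_exp_le (by linarith)]
    linarith [exp_one_lt_d9]
  have hly : log x ≤ y := (self_le_rpow_of_one_le hl3 (by norm_num)).trans hxy
  have hy1 : 1 ≤ y := hl3.trans hly
  have hq1 : (1 : ℝ) ≤ q := by exact_mod_cast hq
  have htriv := card_residue_le_div_add_one hq a hX.le y
  set G : ℝ := Psi X y * (q : ℝ) ^ (-α) with hG
  have hG0 : 0 ≤ G := by positivity
  have hfin : ∀ A : ℝ, 0 ≤ A → A ≤ C₁ + exp y₀ + 2 → ∀ N : ℝ, N ≤ A * (G * log x + y) →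
      N ≤ (C₁ + exp y₀ + 2) * (G * log x + y) := by
    intro A _ hA N hN
    exact hN.trans (by gcongr)
  have hGl : 0 ≤ G * log x := by positivity
  have he := exp_pos y₀
  rcases lt_or_ge y y₀ with hcase | hcase
  · refine hfin (exp y₀ + 1) (by positivity) (by linarith) _ (htriv.trans ?_)
    have h1 : x ≤ exp y₀ := by
      rw [← log_le_iff_le_exp (by linarith)]
      linarith
    have h2 : X / q ≤ X := div_le_self hX.le hq1
    nlinarith only [h1, h2, hXx, hGl, hy1, he]
  · rcases lt_or_ge X (q * y) with hcase2 | hcase2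
    · refine hfin 2 (by norm_num) (by linarith) _ (htriv.trans ?_)
      have h1 : X / q ≤ y := by
        rw [div_le_iff₀ (by linarith)]
        linarith
      linarith
    · obtain ⟨hα₁, hα₂⟩ := hα x y α ((le_max_left _ _).trans hcase) hx hxy hyx hxα
      have h1 : log X ≤ log x := log_le_log hX hXx
      have h2 := hmain y α (log X) X q a ((le_max_right _ _).trans hcase) hα₁ hα₂
        (log_le_log (by linarith) (by nlinarith only [hcase2, hq1, hy1]))
        (h1.trans hxα.ge) hX rfl hq
        (log_le_log (by linarith) (by nlinarith only [hcase2, hq1, hy1]))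
      refine hfin C₁ hC₁.le (by linarith) _ (h2.trans ?_)
      have h3 : log X * (q : ℝ) ^ (-α) * Psi X y = G * log X := by rw [hG]; ring
      rw [h3]
      gcongr

end SmoothCong

/-- Bound (2.4): 𝔗_j(q) ≪ Ψ(x/(2^j qLy), y)² q^(−α) log x + y Ψ(x/(2^j qLy), y). -/
theorem Tmax_q_bound :
    ∃ C : ℝ, 0 < C ∧
      ∀ (x y : ℝ) (q : ℕ) (δ L : ℝ) (j : ℕ) (α : ℝ),
        3 ≤ x → Real.log x ^ (1.1 : ℝ) ≤ y → y ≤ x ^ ((1 : ℝ) / 3) →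
        1 ≤ q → L = 2 * (1 + |δ * x|) →
        (j : ℝ) ≤ Real.log y / Real.log 2 → alphaEq x y α →
        (Tmax y (x / (2 ^ j * q * L * y)) q : ℝ) ≤
          C * ((Psi (x / (2 ^ j * q * L * y)) y : ℝ) ^ 2 * (q : ℝ) ^ (-α) * Real.log x +
            y * (Psi (x / (2 ^ j * q * L * y)) y : ℝ)) := by
  obtain ⟨C, hC, hbound⟩ := SmoothCong.exists_card_residue_le_of_alphaEq
  refine ⟨C, hC, ?_⟩
  intro x y q δ L j α hx hxy hyx hq hL _ hα
  have hl1 : 1 ≤ Real.log x := by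
    rw [Real.le_log_iff_exp_le (by linarith)]
    linarith [Real.exp_one_lt_d9]
  have hy1 : 1 ≤ y := (Real.one_le_rpow hl1 (by norm_num)).trans hxy
  have hL1 : 1 ≤ L := by
    rw [hL]
    linarith [abs_nonneg (δ * x)]
  have hq1 : (1 : ℝ) ≤ q := by exact_mod_cast hq
  have hD : 1 ≤ 2 ^ j * (q : ℝ) * L * y :=
    one_le_mul_of_one_le_of_one_le (one_le_mul_of_one_le_of_one_le
      (one_le_mul_of_one_le_of_one_le (one_le_pow₀ (by norm_num)) hq1) hL1) hy1
  set X := x / (2 ^ j * q * L * y) with hX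
  have hX0 : 0 < X := by positivity
  have hXx : X ≤ x := div_le_self (by linarith) hD
  obtain hne | hne := (Finset.Icc 1 (q - 1)).eq_empty_or_nonempty
  · rw [Tmax, hne]
    simp only [Finset.sup_empty, Nat.bot_eq_zero, Nat.cast_zero]
    positivity
  · obtain ⟨b, -, hb⟩ := Finset.exists_mem_eq_sup _ hne (Tcount y X q)
    rw [Tmax, hb]
    refine (SmoothCong.Tcount_le fun a => hbound x y α X q a hx hxy hyx hα hq hX0 hXx).trans ?_
    exact le_of_eq (by ring)
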